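/- arXiv:2306.15707 — 5 statements merged into one kernel-verified Lean document; each statement's English description precedes it below -/
import Mathlib

section
/- For every real number θ, let G(θ) be the 4×4 complex matrix whose rows are (1, e^{iθ}, 0, e^{−iθ}), (e^{−iθ}, 1, e^{iθ}, 0), (0, e^{−iθ}, 1, e^{iθ}), (e^{iθ}, 0, e^{−iθ}, 1). Then the characteristic polynomial of G(θ) equals (X − (1 + 2cos θ))·(X − (1 − 2cos θ))·(X − (1 + 2sin θ))·(X − (1 − 2sin θ)); in particular det G(θ) = −1 − 2cos(4θ), and at θ = 5π/6 the eigenvalues of G(θ) are 0, 2, 1 + √3, 1 − √3. -/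
open Complex ComplexConjugate Matrix Polynomial

noncomputable section

/-- Signature (3,1) weights of the Hermitian form `H = diag(1,1,1,-1)`. -/
def eta4 : Fin 4 → ℂ := ![1, 1, 1, -1]

/-- The Hermitian matrix `H = diag(1,1,1,-1)`. -/
def H4 : Matrix (Fin 4) (Fin 4) ℂ := Matrix.diagonal eta4

/-- The Hermitian form `⟨z,w⟩ = z₁ conj w₁ + z₂ conj w₂ + z₃ conj w₃ - z₄ conj w₄`. -/
def herm4 (z w : Fin 4 → ℂ) : ℂ :=
  z 0 * conj (w 0) + z 1 * conj (w 1) + z 2 * conj (w 2) - z 3 * conj (w 3)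

/-- The (real) value `⟨z,z⟩` of the Hermitian form. -/
def q4 (z : Fin 4 → ℂ) : ℝ :=
  Complex.normSq (z 0) + Complex.normSq (z 1) + Complex.normSq (z 2) - Complex.normSq (z 3)

/-- The order-4 symmetry `J = diag(-1, i, -i, 1)`. -/
def J4 : Matrix (Fin 4) (Fin 4) ℂ := Matrix.diagonal ![-1, Complex.I, -Complex.I, 1]

/-- The polar vector `n₁` of the paper. -/
def n1v (θ : ℝ) : Fin 4 → ℂ :=
  ![((Real.sqrt (1 - 2 * Real.cos θ) / 2 : ℝ) : ℂ),
    ((Real.sqrt (1 - 2 * Real.sin θ) / 2 : ℝ) : ℂ),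
    ((Real.sqrt (1 + 2 * Real.sin θ) / 2 : ℝ) : ℂ),
    ((Real.sqrt (-1 - 2 * Real.cos θ) / 2 : ℝ) : ℂ)]

/-- `nvec θ k` is the vector `n_{k+1}` of the paper, i.e. `J^k n₁`. -/
def nvec (θ : ℝ) (k : Fin 4) : Fin 4 → ℂ := (J4 ^ (k : ℕ)).mulVec (n1v θ)

/-- The matrix of the order-two complex reflection `z ↦ -z + 2⟨z,n⟩ n`. -/
def refl4 (n : Fin 4 → ℂ) : Matrix (Fin 4) (Fin 4) ℂ :=
  -(1 : Matrix (Fin 4) (Fin 4) ℂ) +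
    (2 : ℂ) • Matrix.vecMulVec n (fun k => conj (n k) * eta4 k)

/-- `Iref θ k` is the complex reflection `I_{k+1}` of the paper. -/
def Iref (θ : ℝ) (k : Fin 4) : Matrix (Fin 4) (Fin 4) ℂ := refl4 (nvec θ k)

/-- `Amat θ k` is `A_{k+1} = I_{k+1} · I_{k+2}` (indices mod 4). -/
def Amat (θ : ℝ) (k : Fin 4) : Matrix (Fin 4) (Fin 4) ℂ := Iref θ k * Iref θ (k + 1)

/-- The Dirichlet center `p₀ = (0,0,0,1)ᵗ`. -/
def p0v : Fin 4 → ℂ := ![0, 0, 0, 1]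

/-- `pv θ i j` is `p_{(i+1)(j+1)} = I_{i+1} I_{j+1} p₀`. -/
def pv (θ : ℝ) (i j : Fin 4) : Fin 4 → ℂ := (Iref θ i * Iref θ j).mulVec p0v

/-- The Gram matrix `G(θ)` of the paper. -/
def Gmat (θ : ℝ) : Matrix (Fin 4) (Fin 4) ℂ :=
  !![1, Complex.exp ((θ : ℂ) * Complex.I), 0, Complex.exp (-(θ : ℂ) * Complex.I);
     Complex.exp (-(θ : ℂ) * Complex.I), 1, Complex.exp ((θ : ℂ) * Complex.I), 0;
     0, Complex.exp (-(θ : ℂ) * Complex.I), 1, Complex.exp ((θ : ℂ) * Complex.I);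
     Complex.exp ((θ : ℂ) * Complex.I), 0, Complex.exp (-(θ : ℂ) * Complex.I), 1]

theorem Gmat_det_aux (θ : ℝ) (x : ℂ) :
    (Matrix.scalar (Fin 4) x - Gmat θ).det =
      ((x - 1) ^ 2 - 4 * (Real.cos θ : ℂ) ^ 2) * ((x - 1) ^ 2 - 4 * (Real.sin θ : ℂ) ^ 2) := by
  have hcs : (Real.cos θ : ℂ) ^ 2 + (Real.sin θ : ℂ) ^ 2 = 1 := by
    exact_mod_cast Real.cos_sq_add_sin_sq θ
  have ha : Complex.exp ((θ : ℂ) * Complex.I) = Real.cos θ + Real.sin θ * Complex.I := by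
    rw [Complex.exp_mul_I, Complex.ofReal_cos, Complex.ofReal_sin]
  have hb : Complex.exp (-(θ : ℂ) * Complex.I) = Real.cos θ - Real.sin θ * Complex.I := by
    rw [Complex.exp_mul_I, Complex.ofReal_cos, Complex.ofReal_sin, Complex.cos_neg,
      Complex.sin_neg]
    ring
  have hI : Complex.I ^ 2 = -1 := Complex.I_sq
  unfold Gmat
  rw [ha, hb]
  generalize (Real.cos θ : ℂ) = c at *
  generalize (Real.sin θ : ℂ) = s at *
  generalize Complex.I = j at *
  have hM : Matrix.scalar (Fin 4) x - !![1, c + s * j, 0, c - s * j;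
      c - s * j, 1, c + s * j, 0; 0, c - s * j, 1, c + s * j;
      c + s * j, 0, c - s * j, 1] = !![x - 1, -(c + s * j), 0, -(c - s * j);
      -(c - s * j), x - 1, -(c + s * j), 0; 0, -(c - s * j), x - 1, -(c + s * j);
      -(c + s * j), 0, -(c - s * j), x - 1] := by
    ext i k
    fin_cases i <;> fin_cases k <;> simp
  rw [hM]
  simp [Matrix.det_succ_row_zero, Fin.sum_univ_succ, Fin.succAbove]
  grind

theorem Gmat_charpoly (θ : ℝ) :
    (Gmat θ).charpoly =
        (X - C ((1 + 2 * Real.cos θ : ℝ) : ℂ)) *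
        (X - C ((1 - 2 * Real.cos θ : ℝ) : ℂ)) *
        (X - C ((1 + 2 * Real.sin θ : ℝ) : ℂ)) *
        (X - C ((1 - 2 * Real.sin θ : ℝ) : ℂ)) := by
  apply Polynomial.funext
  intro x
  rw [Matrix.eval_charpoly, Gmat_det_aux]
  simp only [eval_mul, eval_sub, eval_X, eval_C]
  push_cast
  ring

/-- the characteristic polynomial of `G(θ)` factors as
`(X - (1+2cos θ))(X - (1-2cos θ))(X - (1+2sin θ))(X - (1-2sin θ))`; in particular
`det G(θ) = -1 - 2cos(4θ)`, and at `θ = 5π/6` the eigenvalues of `G(θ)` are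
`0, 2, 1+√3, 1-√3`. -/
theorem charpoly_Gram (θ : ℝ) :
    (Gmat θ).charpoly =
        (X - C ((1 + 2 * Real.cos θ : ℝ) : ℂ)) *
        (X - C ((1 - 2 * Real.cos θ : ℝ) : ℂ)) *
        (X - C ((1 + 2 * Real.sin θ : ℝ) : ℂ)) *
        (X - C ((1 - 2 * Real.sin θ : ℝ) : ℂ)) ∧
    (Gmat θ).det = ((-1 - 2 * Real.cos (4 * θ) : ℝ) : ℂ) ∧
    spectrum ℂ (Gmat (5 * Real.pi / 6)) =
      {0, 2, ((1 + Real.sqrt 3 : ℝ) : ℂ), ((1 - Real.sqrt 3 : ℝ) : ℂ)} := by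
  refine ⟨Gmat_charpoly θ, ?_, ?_⟩
  · have h := Gmat_det_aux θ 0
    have h2 : (Gmat θ).det = (Matrix.scalar (Fin 4) (0 : ℂ) - Gmat θ).det := by
      rw [map_zero, zero_sub, Matrix.det_neg]
      simp
      norm_num
    rw [h2, h]
    have hcs := Real.cos_sq_add_sin_sq θ
    have h4 : Real.cos (4 * θ) = 2 * (2 * Real.cos θ ^ 2 - 1) ^ 2 - 1 := by
      rw [← Real.cos_two_mul, ← Real.cos_two_mul]
      ring_nf
    have hs : Real.sin θ ^ 2 = 1 - Real.cos θ ^ 2 := by linarith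
    norm_cast
    rw [h4, hs]
    push_cast
    ring
  · have e : (5 * Real.pi / 6) = Real.pi - Real.pi / 6 := by ring
    have hc : Real.cos (5 * Real.pi / 6) = -(Real.sqrt 3 / 2) := by
      rw [e, Real.cos_pi_sub, Real.cos_pi_div_six]
    have hs : Real.sin (5 * Real.pi / 6) = 1 / 2 := by
      rw [e, Real.sin_pi_sub, Real.sin_pi_div_six]
    ext x
    rw [Matrix.mem_spectrum_iff_isRoot_charpoly, Gmat_charpoly, hc, hs]
    simp only [IsRoot.def, eval_mul, eval_sub, eval_X, eval_C, mul_eq_zero, sub_eq_zero,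
      Set.mem_insert_iff, Set.mem_singleton_iff]
    push_cast
    ring_nf
    tauto
end
end

section
/- For every θ ∈ [5π/6, π] and all 1 ≤ i, j ≤ 4, the inner product ⟨n_i, n_j⟩ equals the (i,j) entry of the matrix G(θ) whose rows are (1, e^{iθ}, 0, e^{−iθ}), (e^{−iθ}, 1, e^{iθ}, 0), (0, e^{−iθ}, 1, e^{iθ}), (e^{iθ}, 0, e^{−iθ}, 1). In particular ⟨n_i, n_i⟩ = 1 for all i, ⟨n₁, n₃⟩ = ⟨n₂, n₄⟩ = 0, and ⟨n₁, n₂⟩ = ⟨n₂, n₃⟩ = ⟨n₃, n₄⟩ = ⟨n₄, n₁⟩ = e^{iθ}. -/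
open Complex ComplexConjugate Matrix Polynomial

noncomputable section

/-- Powers of `J` act diagonally on `n₁`. -/
theorem nvec_apply (θ : ℝ) (k l : Fin 4) :
    nvec θ k l = (![-1, Complex.I, -Complex.I, 1] : Fin 4 → ℂ) l ^ (k : ℕ) * n1v θ l := by
  simp only [nvec, J4, Matrix.diagonal_pow, Matrix.mulVec_diagonal, Pi.pow_apply]

theorem gram_entries (θ : ℝ) (hθ : θ ∈ Set.Icc (5 * Real.pi / 6) Real.pi) (i j : Fin 4) :
    herm4 (nvec θ i) (nvec θ j) = Gmat θ i j := by
  obtain ⟨h1, h2⟩ := hθ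
  have hpi := Real.pi_pos
  have hs0 : 0 ≤ Real.sin θ := Real.sin_nonneg_of_nonneg_of_le_pi (by linarith) h2
  have hs : Real.sin θ ≤ 1 / 2 := by
    rw [← Real.sin_pi_sub, ← Real.sin_pi_div_six]
    exact Real.sin_le_sin_of_le_of_le_pi_div_two (by linarith) (by linarith) (by linarith)
  have hc : Real.cos θ ≤ -(1 / 2) := by
    have h : Real.cos (Real.pi / 3) ≤ Real.cos (Real.pi - θ) :=
      Real.cos_le_cos_of_nonneg_of_le_pi (by linarith) (by linarith) (by linarith)
    rw [Real.cos_pi_sub, Real.cos_pi_div_three] at h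
    linarith
  have ha : ((Real.sqrt (1 - 2 * Real.cos θ) : ℝ) : ℂ) ^ 2 = 1 - 2 * (Real.cos θ : ℂ) := by
    rw [← Complex.ofReal_pow, Real.sq_sqrt (by linarith)]; push_cast; ring
  have hb : ((Real.sqrt (1 - 2 * Real.sin θ) : ℝ) : ℂ) ^ 2 = 1 - 2 * (Real.sin θ : ℂ) := by
    rw [← Complex.ofReal_pow, Real.sq_sqrt (by linarith)]; push_cast; ring
  have hd : ((Real.sqrt (1 + 2 * Real.sin θ) : ℝ) : ℂ) ^ 2 = 1 + 2 * (Real.sin θ : ℂ) := by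
    rw [← Complex.ofReal_pow, Real.sq_sqrt (by linarith)]; push_cast; ring
  have he : ((Real.sqrt (-1 - 2 * Real.cos θ) : ℝ) : ℂ) ^ 2 = -1 - 2 * (Real.cos θ : ℂ) := by
    rw [← Complex.ofReal_pow, Real.sq_sqrt (by linarith)]; push_cast; ring
  have hp : Complex.exp ((θ : ℂ) * Complex.I)
      = (Real.cos θ : ℂ) + (Real.sin θ : ℂ) * Complex.I := by
    rw [Complex.exp_mul_I, Complex.ofReal_cos, Complex.ofReal_sin]
  have hm : Complex.exp (-(θ : ℂ) * Complex.I)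
      = (Real.cos θ : ℂ) - (Real.sin θ : ℂ) * Complex.I := by
    rw [Complex.exp_mul_I, Complex.cos_neg, Complex.sin_neg, Complex.ofReal_cos,
      Complex.ofReal_sin]; ring
  have h2c : (starRingEnd ℂ) 2 = 2 := Complex.conj_ofNat 2
  have hI := Complex.I_sq
  simp only [herm4, nvec_apply, n1v, Gmat, hp, hm, map_mul, map_pow, Complex.ofReal_div,
    map_div₀]
  generalize Real.sqrt (1 - 2 * Real.cos θ) = a at *
  generalize Real.sqrt (1 - 2 * Real.sin θ) = b at *
  generalize Real.sqrt (1 + 2 * Real.sin θ) = d at *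
  generalize Real.sqrt (-1 - 2 * Real.cos θ) = e at *
  generalize (Real.cos θ : ℂ) = c at *
  generalize (Real.sin θ : ℂ) = s at *
  clear hp hm
  fin_cases i <;> fin_cases j <;> simp [h2c] <;> grind

/-- for `θ ∈ [5π/6, π]` the inner products `⟨n_i, n_j⟩` realize the
Gram matrix `G(θ)`; in particular `⟨n_i,n_i⟩ = 1`, `⟨n₁,n₃⟩ = ⟨n₂,n₄⟩ = 0` and
`⟨n₁,n₂⟩ = ⟨n₂,n₃⟩ = ⟨n₃,n₄⟩ = ⟨n₄,n₁⟩ = e^{iθ}`.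
(Here `nvec θ k` is `n_{k+1}`, so indices are shifted by one.) -/
theorem gram_matrix_of_polar_vectors (θ : ℝ)
    (hθ : θ ∈ Set.Icc (5 * Real.pi / 6) Real.pi) :
    (∀ i j : Fin 4, herm4 (nvec θ i) (nvec θ j) = Gmat θ i j) ∧
    (∀ i : Fin 4, herm4 (nvec θ i) (nvec θ i) = 1) ∧
    herm4 (nvec θ 0) (nvec θ 2) = 0 ∧
    herm4 (nvec θ 1) (nvec θ 3) = 0 ∧
    herm4 (nvec θ 0) (nvec θ 1) = Complex.exp ((θ : ℂ) * Complex.I) ∧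
    herm4 (nvec θ 1) (nvec θ 2) = Complex.exp ((θ : ℂ) * Complex.I) ∧
    herm4 (nvec θ 2) (nvec θ 3) = Complex.exp ((θ : ℂ) * Complex.I) ∧
    herm4 (nvec θ 3) (nvec θ 0) = Complex.exp ((θ : ℂ) * Complex.I) := by
  have h := gram_entries θ hθ
  refine ⟨h, fun i => ?_, ?_, ?_, ?_, ?_, ?_, ?_⟩
  · rw [h]
    fin_cases i <;> simp [Gmat]
  all_goals
    rw [h]
    simp [Gmat]
end
end

section
/- For every θ ∈ [5π/6, π], the matrices satisfy the Coxeter relations (I₁·I₃)² = Id and (I₂·I₄)² = Id, and consequently A₁·A₂·A₃·A₄ = Id where A_i = I_i·I_{i+1} (indices mod 4). Hence ι_i ↦ I_i defines a group homomorphism from the abstract Coxeter group G = ⟨ι₁,ι₂,ι₃,ι₄ | ι_i² = (ι₁ι₃)² = (ι₂ι₄)² = 1⟩ into GL(4,ℂ). -/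
open Complex ComplexConjugate Matrix Polynomial

noncomputable section

/-- The relations of the abstract Coxeter group
`G = ⟨ι₁,ι₂,ι₃,ι₄ | ι_i² = (ι₁ι₃)² = (ι₂ι₄)² = 1⟩` (generators indexed by `Fin 4`,
with `ι_{k+1}` corresponding to index `k`). -/
def coxeterRels : Set (FreeGroup (Fin 4)) :=
  (Set.range fun i : Fin 4 => FreeGroup.of i ^ 2) ∪
    {(FreeGroup.of 0 * FreeGroup.of 2) ^ 2, (FreeGroup.of 1 * FreeGroup.of 3) ^ 2}

theorem aux_mul (n m : Fin 4 → ℂ) :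
    Matrix.vecMulVec n (fun k => conj (n k) * eta4 k) *
      Matrix.vecMulVec m (fun k => conj (m k) * eta4 k) =
    herm4 m n • Matrix.vecMulVec n (fun k => conj (m k) * eta4 k) := by
  ext i j
  simp only [Matrix.mul_apply, Matrix.vecMulVec_apply, Fin.sum_univ_four, Matrix.smul_apply,
    smul_eq_mul, herm4, eta4]
  simp
  ring

theorem aux_sq (n : Fin 4 → ℂ) (h : herm4 n n = 1) : refl4 n * refl4 n = 1 := by
  have := aux_mul n n
  rw [h, one_smul] at this
  simp only [refl4, add_mul, mul_add, neg_mul, mul_neg, one_mul, mul_one, smul_mul_assoc,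
    mul_smul_comm, this, smul_smul]
  module

theorem aux_comm (n m : Fin 4 → ℂ) (h : herm4 n m = 0) (h' : herm4 m n = 0) :
    refl4 n * refl4 m = refl4 m * refl4 n := by
  have h1 := aux_mul n m
  have h2 := aux_mul m n
  rw [h', zero_smul] at h1
  rw [h, zero_smul] at h2
  simp only [refl4, add_mul, mul_add, neg_mul, mul_neg, one_mul, mul_one, smul_mul_assoc,
    mul_smul_comm, h1, h2, smul_smul]
  module

theorem aux_nvec (θ : ℝ) (k j : Fin 4) :
    nvec θ k j = (![-1, Complex.I, -Complex.I, 1] : Fin 4 → ℂ) j ^ (k : ℕ) * n1v θ j := by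
  simp [nvec, J4, Matrix.diagonal_pow, Matrix.mulVec_diagonal]

theorem aux_rad (θ : ℝ) (hθ : θ ∈ Set.Icc (5 * Real.pi / 6) Real.pi) :
    Real.cos θ ≤ -1/2 ∧ 0 ≤ Real.sin θ ∧ Real.sin θ ≤ 1/2 := by
  obtain ⟨h1, h2⟩ := hθ
  have hp := Real.pi_pos
  have e1 : Real.sin θ = Real.sin (Real.pi - θ) := (Real.sin_pi_sub θ).symm
  have e2 : Real.cos θ = - Real.cos (Real.pi - θ) := by rw [Real.cos_pi_sub]; ring
  refine ⟨?_, Real.sin_nonneg_of_nonneg_of_le_pi (by linarith) h2, ?_⟩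
  · have := Real.cos_le_cos_of_nonneg_of_le_pi (x := Real.pi - θ) (y := Real.pi / 3)
      (by linarith) (by linarith) (by linarith)
    rw [Real.cos_pi_div_three] at this
    linarith
  · have := Real.sin_le_sin_of_le_of_le_pi_div_two (x := Real.pi - θ) (y := Real.pi / 6)
      (by linarith) (by linarith) (by linarith)
    rw [Real.sin_pi_div_six] at this
    linarith

theorem aux_sqrt (x : ℝ) (hx : 0 ≤ x) :
    ((Real.sqrt x : ℝ) : ℂ) ^ 2 = (x : ℂ) := by
  rw [← Complex.ofReal_pow, Real.sq_sqrt hx]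

theorem aux_herm (θ : ℝ) (hθ : θ ∈ Set.Icc (5 * Real.pi / 6) Real.pi) :
    (∀ i, herm4 (nvec θ i) (nvec θ i) = 1) ∧
    herm4 (nvec θ 0) (nvec θ 2) = 0 ∧ herm4 (nvec θ 2) (nvec θ 0) = 0 ∧
    herm4 (nvec θ 1) (nvec θ 3) = 0 ∧ herm4 (nvec θ 3) (nvec θ 1) = 0 := by
  obtain ⟨hc, hs0, hs⟩ := aux_rad θ hθ
  have a := aux_sqrt (1 - 2 * Real.cos θ) (by linarith)
  have b := aux_sqrt (1 - 2 * Real.sin θ) (by linarith)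
  have c := aux_sqrt (1 + 2 * Real.sin θ) (by linarith)
  have d := aux_sqrt (-1 - 2 * Real.cos θ) (by linarith)
  have hI : Complex.I ^ 2 = -1 := Complex.I_sq
  have hI4 : Complex.I ^ 4 = 1 := Complex.I_pow_four
  have hI6 : Complex.I ^ 6 = -1 := by rw [show (6 : ℕ) = 4 + 2 from rfl, pow_add, hI4, hI, one_mul]
  push_cast at a b c d
  have r1 : ((√(1 - 2 * Real.cos θ) : ℝ) : ℂ) ^ 2 + ((√(1 - 2 * Real.sin θ) : ℝ) : ℂ) ^ 2 +
      ((√(1 + 2 * Real.sin θ) : ℝ) : ℂ) ^ 2 - ((√(-1 - 2 * Real.cos θ) : ℝ) : ℂ) ^ 2 = 4 := by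
    rw [a, b, c, d]; ring
  have r2 : ((√(1 - 2 * Real.cos θ) : ℝ) : ℂ) ^ 2 - ((√(1 - 2 * Real.sin θ) : ℝ) : ℂ) ^ 2 -
      ((√(1 + 2 * Real.sin θ) : ℝ) : ℂ) ^ 2 - ((√(-1 - 2 * Real.cos θ) : ℝ) : ℂ) ^ 2 = 0 := by
    rw [a, b, c, d]; ring
  simp only [herm4, aux_nvec, n1v]
  clear a b c d
  generalize √(1 - 2 * Real.cos θ) = a at *
  generalize √(1 - 2 * Real.sin θ) = b at *
  generalize √(1 + 2 * Real.sin θ) = c at *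
  generalize √(-1 - 2 * Real.cos θ) = d at *
  refine ⟨fun i => ?_, ?_, ?_, ?_, ?_⟩
  · fin_cases i <;> simp [map_ofNat] <;> ring_nf <;>
      (try simp only [hI, hI4, hI6]) <;> linear_combination r1 / 4
  all_goals
    simp [map_ofNat]
    ring_nf
    (try simp only [hI, hI4, hI6])
    linear_combination r2 / 4

/-- for `θ ∈ [5π/6, π]` the Coxeter relations `(I₁I₃)² = (I₂I₄)² = Id`
hold, consequently `A₁A₂A₃A₄ = Id`, and `ι_i ↦ I_i` defines a group homomorphism
from the abstract Coxeter group `G` into `GL(4,ℂ)`.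
(Here `Iref θ k` is `I_{k+1}` and `Amat θ k` is `A_{k+1}`.) -/
theorem coxeter_relations_and_representation (θ : ℝ)
    (hθ : θ ∈ Set.Icc (5 * Real.pi / 6) Real.pi) :
    (Iref θ 0 * Iref θ 2) * (Iref θ 0 * Iref θ 2) = 1 ∧
    (Iref θ 1 * Iref θ 3) * (Iref θ 1 * Iref θ 3) = 1 ∧
    Amat θ 0 * Amat θ 1 * Amat θ 2 * Amat θ 3 = 1 ∧
    ∃ φ : PresentedGroup coxeterRels →* (Matrix (Fin 4) (Fin 4) ℂ)ˣ,
      ∀ i : Fin 4, (φ (PresentedGroup.of i) : Matrix (Fin 4) (Fin 4) ℂ) = Iref θ i := by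
  obtain ⟨hn, h02, h20, h13, h31⟩ := aux_herm θ hθ
  have sq : ∀ i, Iref θ i * Iref θ i = 1 := fun i => aux_sq _ (hn i)
  have c02 : Iref θ 0 * Iref θ 2 = Iref θ 2 * Iref θ 0 := aux_comm _ _ h02 h20
  have c13 : Iref θ 1 * Iref θ 3 = Iref θ 3 * Iref θ 1 := aux_comm _ _ h13 h31
  have key : ∀ i j, Iref θ i * Iref θ j = Iref θ j * Iref θ i →
      (Iref θ i * Iref θ j) * (Iref θ i * Iref θ j) = 1 := by
    intro i j h
    calc (Iref θ i * Iref θ j) * (Iref θ i * Iref θ j)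
        = (Iref θ i * Iref θ j) * (Iref θ j * Iref θ i) := by rw [← h]
      _ = Iref θ i * (Iref θ j * Iref θ j) * Iref θ i := by simp only [mul_assoc]
      _ = 1 := by rw [sq, mul_one, sq]
  refine ⟨key 0 2 c02, key 1 3 c13, ?_, ?_⟩
  · have e1 : ((0 : Fin 4) + 1) = 1 := rfl
    have e2 : ((1 : Fin 4) + 1) = 2 := rfl
    have e3 : ((2 : Fin 4) + 1) = 3 := rfl
    have e4 : ((3 : Fin 4) + 1) = 0 := rfl
    simp only [Amat, e1, e2, e3, e4]
    calc Iref θ 0 * Iref θ 1 * (Iref θ 1 * Iref θ 2) * (Iref θ 2 * Iref θ 3) *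
          (Iref θ 3 * Iref θ 0)
        = Iref θ 0 * (Iref θ 1 * Iref θ 1) * (Iref θ 2 * Iref θ 2) * (Iref θ 3 * Iref θ 3) *
          Iref θ 0 := by simp only [mul_assoc]
      _ = 1 := by rw [sq, sq, sq, mul_one, mul_one, mul_one, sq]
  · let u : Fin 4 → (Matrix (Fin 4) (Fin 4) ℂ)ˣ := fun i => ⟨Iref θ i, Iref θ i, sq i, sq i⟩
    have hu : ∀ i, ((u i : (Matrix (Fin 4) (Fin 4) ℂ)ˣ) : Matrix (Fin 4) (Fin 4) ℂ) = Iref θ i :=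
      fun _ => rfl
    have hrel : ∀ r ∈ coxeterRels, FreeGroup.lift u r = 1 := by
      rintro r (⟨i, rfl⟩ | rfl | rfl)
      · apply Units.ext
        simp [hu, pow_two, sq]
      · apply Units.ext
        simpa [hu, pow_two] using key 0 2 c02
      · apply Units.ext
        simpa [hu, pow_two] using key 1 3 c13
    exact ⟨PresentedGroup.toGroup hrel, fun i => by rw [PresentedGroup.toGroup.of]⟩
end
end

section
/- (Main theorem, discreteness and faithfulness of ρ_θ on K.) For every θ ∈ [5π/6, π], the matrices A₁, A₂, A₃, A₄ ∈ GL(4,ℂ) satisfy A₁A₂A₃A₄ = Id and (A₁A₂)² = (A₂A₃)² = (A₃A₄)² = (A₄A₁)² = Id; the induced group homomorphism from the presented group K = ⟨a₁,a₂,a₃,a₄ | a₁a₂a₃a₄ = (a₁a₂)² = (a₂a₃)² = (a₃a₄)² = (a₄a₁)² = 1⟩ to GL(4,ℂ) sending a_i to A_i is injective; and the subgroup of GL(4,ℂ) generated by A₁, A₂, A₃, A₄ is discrete, i.e. it carries the discrete topology as a topological subspace of GL(4,ℂ). -/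
open Complex ComplexConjugate Matrix Polynomial

noncomputable section

/-- The relations of the presented group
`K = ⟨a₁,a₂,a₃,a₄ | a₁a₂a₃a₄ = (a₁a₂)² = (a₂a₃)² = (a₃a₄)² = (a₄a₁)² = 1⟩`
(generators indexed by `Fin 4`, with `a_{k+1}` corresponding to index `k`). -/
def relsK : Set (FreeGroup (Fin 4)) :=
  { FreeGroup.of 0 * FreeGroup.of 1 * FreeGroup.of 2 * FreeGroup.of 3,
    (FreeGroup.of 0 * FreeGroup.of 1) ^ 2,
    (FreeGroup.of 1 * FreeGroup.of 2) ^ 2,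
    (FreeGroup.of 2 * FreeGroup.of 3) ^ 2,
    (FreeGroup.of 3 * FreeGroup.of 0) ^ 2 }

/-! ### Entries of the polar vectors -/

def naR (θ : ℝ) : ℝ := Real.sqrt (1 - 2 * Real.cos θ) / 2
def nbR (θ : ℝ) : ℝ := Real.sqrt (1 - 2 * Real.sin θ) / 2
def ncR (θ : ℝ) : ℝ := Real.sqrt (1 + 2 * Real.sin θ) / 2
def tR (θ : ℝ) : ℝ := Real.sqrt (-1 - 2 * Real.cos θ) / 2

/-- The Gram entry `e^{iθ}`. -/
def eC (θ : ℝ) : ℂ := ⟨Real.cos θ, Real.sin θ⟩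

lemma nvec_0 (θ : ℝ) : nvec θ 0 = ![(naR θ : ℂ), (nbR θ : ℂ), (ncR θ : ℂ), (tR θ : ℂ)] := by
  simp [nvec, n1v, naR, nbR, ncR, tR]

lemma nvec_1 (θ : ℝ) : nvec θ 1 =
    ![-(naR θ : ℂ), Complex.I * (nbR θ : ℂ), -(Complex.I * (ncR θ : ℂ)), (tR θ : ℂ)] := by
  ext i
  fin_cases i <;> simp [nvec, n1v, naR, nbR, ncR, tR, J4, Matrix.mulVec_diagonal]

lemma nvec_2 (θ : ℝ) : nvec θ 2 =
    ![(naR θ : ℂ), -(nbR θ : ℂ), -(ncR θ : ℂ), (tR θ : ℂ)] := by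
  ext i
  fin_cases i <;>
    simp [nvec, n1v, naR, nbR, ncR, tR, J4, Matrix.diagonal_pow, Matrix.mulVec_diagonal]

lemma nvec_3 (θ : ℝ) : nvec θ 3 =
    ![-(naR θ : ℂ), -(Complex.I * (nbR θ : ℂ)), Complex.I * (ncR θ : ℂ), (tR θ : ℂ)] := by
  ext i
  fin_cases i <;>
    simp [nvec, n1v, naR, nbR, ncR, tR, J4, Matrix.diagonal_pow, Matrix.mulVec_diagonal,
      pow_succ, mul_assoc, ← Complex.ofReal_ofNat] 

/-- Admissible angles, in the form used below. -/
structure Adm (θ : ℝ) : Prop where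
  c_le : Real.cos θ ≤ -(Real.sqrt 3 / 2)
  s_nn : 0 ≤ Real.sin θ
  s_le : Real.sin θ ≤ 1 / 2

lemma adm_of_mem {θ : ℝ} (hθ : θ ∈ Set.Icc (5 * Real.pi / 6) Real.pi) : Adm θ := by
  obtain ⟨h1, h2⟩ := hθ
  have hp := Real.pi_pos
  refine ⟨?_, ?_, ?_⟩
  · have h := Real.cos_le_cos_of_nonneg_of_le_pi (x := 5 * Real.pi / 6) (y := θ)
      (by positivity) h2 h1
    have h5 : Real.cos (5 * Real.pi / 6) = -(Real.sqrt 3 / 2) := by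
      rw [← Real.cos_pi_div_six, ← Real.cos_pi_sub]; congr 1; ring
    linarith
  · exact Real.sin_nonneg_of_nonneg_of_le_pi (by linarith) h2
  · have h := Real.sin_le_sin_of_le_of_le_pi_div_two (x := Real.pi - θ) (y := Real.pi / 6)
      (by linarith) (by linarith) (by linarith)
    rw [Real.sin_pi_sub, Real.sin_pi_div_six] at h
    exact h

namespace Adm

lemma c_sq {θ : ℝ} (h : Adm θ) : 3 / 4 ≤ Real.cos θ ^ 2 := by
  have h3 : Real.sqrt 3 ^ 2 = 3 := Real.sq_sqrt (by norm_num)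
  nlinarith [h.c_le, Real.sqrt_nonneg 3]

lemma c_lt {θ : ℝ} (h : Adm θ) : Real.cos θ < -(4 / 5) := by
  have h3 : (8 : ℝ) / 5 < Real.sqrt 3 := by
    apply Real.lt_sqrt_of_sq_lt; norm_num
  linarith [h.c_le]

lemma na_sq {θ : ℝ} (h : Adm θ) : naR θ ^ 2 = (1 - 2 * Real.cos θ) / 4 := by
  rw [naR, div_pow, Real.sq_sqrt (by linarith [h.c_lt])]; norm_num
lemma nb_sq {θ : ℝ} (h : Adm θ) : nbR θ ^ 2 = (1 - 2 * Real.sin θ) / 4 := by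
  rw [nbR, div_pow, Real.sq_sqrt (by linarith [h.s_le])]; norm_num
lemma nc_sq {θ : ℝ} (h : Adm θ) : ncR θ ^ 2 = (1 + 2 * Real.sin θ) / 4 := by
  rw [ncR, div_pow, Real.sq_sqrt (by linarith [h.s_nn])]; norm_num
lemma t_sq {θ : ℝ} (h : Adm θ) : tR θ ^ 2 = (-1 - 2 * Real.cos θ) / 4 := by
  rw [tR, div_pow, Real.sq_sqrt (by linarith [h.c_lt])]; norm_num
lemma t_pos {θ : ℝ} (h : Adm θ) : 0 < tR θ := by
  rw [tR]; have := Real.sqrt_pos.mpr (show 0 < -1 - 2 * Real.cos θ by linarith [h.c_lt]); linarith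

end Adm

/-! ### The reflections acting on vectors -/

/-- `Ia θ k z = I_k z`. -/
def Ia (θ : ℝ) (k : Fin 4) (z : Fin 4 → ℂ) : Fin 4 → ℂ := (Iref θ k).mulVec z

lemma Ia_eq (θ : ℝ) (k : Fin 4) (z : Fin 4 → ℂ) :
    Ia θ k z = -z + (2 * herm4 z (nvec θ k)) • nvec θ k := by
  ext i
  simp only [Ia, Iref, refl4, Matrix.add_mulVec, Matrix.neg_mulVec, Matrix.one_mulVec,
    Matrix.smul_mulVec, Matrix.vecMulVec_mulVec, Pi.add_apply, Pi.neg_apply, Pi.smul_apply,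
    smul_eq_mul]
  simp [dotProduct, Fin.sum_univ_four, eta4, herm4]
  ring

/-- `xx θ k z = 2 t ⟨z, n_k⟩`. -/
def xx (θ : ℝ) (k : Fin 4) (z : Fin 4 → ℂ) : ℂ := 2 * tR θ * herm4 z (nvec θ k)

lemma nvec_last (θ : ℝ) (k : Fin 4) : nvec θ k 3 = tR θ := by
  fin_cases k
  · simp [nvec_0]
  · simp [nvec_1]
  · simp [nvec_2]
  · simp [nvec_3]

lemma Ia_last (θ : ℝ) (k : Fin 4) (z : Fin 4 → ℂ) : Ia θ k z 3 = -(z 3) + xx θ k z := by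
  rw [Ia_eq]
  simp only [Pi.add_apply, Pi.neg_apply, Pi.smul_apply, smul_eq_mul, nvec_last, xx]
  ring

lemma herm4_Ia (θ : ℝ) (k : Fin 4) (z v : Fin 4 → ℂ) :
    herm4 (Ia θ k z) v = - herm4 z v + 2 * herm4 z (nvec θ k) * herm4 (nvec θ k) v := by
  rw [Ia_eq]
  simp only [herm4, Pi.add_apply, Pi.neg_apply, Pi.smul_apply, smul_eq_mul]
  ring

lemma eC_re (θ : ℝ) : (eC θ).re = Real.cos θ := rfl
lemma eC_im (θ : ℝ) : (eC θ).im = Real.sin θ := rfl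

/-- The Gram matrix of the polar vectors. -/
def gramK (θ : ℝ) (k j : Fin 4) : ℂ :=
  if j = k then 1 else if j = k + 1 then eC θ else if j = k + 2 then 0 else conj (eC θ)

lemma gram_eq {θ : ℝ} (h : Adm θ) (k j : Fin 4) : herm4 (nvec θ k) (nvec θ j) = gramK θ k j := by
  have ha := h.na_sq
  have hb := h.nb_sq
  have hc := h.nc_sq
  have ht := h.t_sq
  fin_cases k <;> fin_cases j <;>
    simp [gramK, nvec_0, nvec_1, nvec_2, nvec_3, herm4, Complex.ext_iff, eC_re, eC_im] <;>
    (try constructor) <;> nlinarith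

lemma xx_Ia {θ : ℝ} (h : Adm θ) (k j : Fin 4) (z : Fin 4 → ℂ) :
    xx θ j (Ia θ k z) = - xx θ j z + 2 * gramK θ k j * xx θ k z := by
  rw [xx, herm4_Ia, gram_eq h, xx, xx]; ring


/-! ### Involutions, commutation, invariance of the form -/

lemma herm4_conj (z v : Fin 4 → ℂ) : herm4 v z = conj (herm4 z v) := by
  simp only [herm4, map_add, map_sub, map_mul, Complex.conj_conj]; ring

lemma gramK_self (θ : ℝ) (k : Fin 4) : gramK θ k k = 1 := by simp [gramK]
lemma gramK_two (θ : ℝ) (k : Fin 4) : gramK θ k (k + 2) = 0 := by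
  fin_cases k <;> simp [gramK]
lemma gramK_two' (θ : ℝ) (k : Fin 4) : gramK θ (k + 2) k = 0 := by
  fin_cases k <;> simp [gramK]

lemma Ia_Ia {θ : ℝ} (h : Adm θ) (k : Fin 4) (z : Fin 4 → ℂ) : Ia θ k (Ia θ k z) = z := by
  rw [Ia_eq θ k (Ia θ k z), herm4_Ia, gram_eq h, gramK_self, Ia_eq]
  ext i
  simp only [Pi.add_apply, Pi.neg_apply, Pi.smul_apply, smul_eq_mul]
  ring

lemma Ia_comm {θ : ℝ} (h : Adm θ) (k : Fin 4) (z : Fin 4 → ℂ) :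
    Ia θ k (Ia θ (k + 2) z) = Ia θ (k + 2) (Ia θ k z) := by
  rw [Ia_eq θ k (Ia θ (k + 2) z), Ia_eq θ (k + 2) (Ia θ k z), herm4_Ia, herm4_Ia, gram_eq h,
    gram_eq h, gramK_two, gramK_two', Ia_eq, Ia_eq]
  ext i
  simp only [Pi.add_apply, Pi.neg_apply, Pi.smul_apply, smul_eq_mul]
  ring

lemma q4_eq (z : Fin 4 → ℂ) : q4 z = (herm4 z z).re := by
  simp only [q4, herm4, Complex.mul_conj, Complex.add_re, Complex.sub_re, Complex.ofReal_re]

lemma q4_Ia {θ : ℝ} (h : Adm θ) (k : Fin 4) (z : Fin 4 → ℂ) : q4 (Ia θ k z) = q4 z := by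
  rw [q4_eq, q4_eq]
  congr 1
  rw [herm4_Ia, herm4_conj (Ia θ k z) z, herm4_conj (Ia θ k z) (nvec θ k), herm4_Ia, herm4_Ia,
    gram_eq h, gramK_self, herm4_conj z (nvec θ k)]
  simp only [map_add, map_neg, map_mul, map_one, ← herm4_conj, map_ofNat]
  ring

/-- The displacement functionals: `DD θ [a₁,…,aₙ] z = ‖(I_{aₙ} ⋯ I_{a₁} z)₃‖`. -/
def DD (θ : ℝ) : List (Fin 4) → (Fin 4 → ℂ) → ℝ
  | [], z => ‖z 3‖
  | a :: l, z => DD θ l (Ia θ a z)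

/-- The rotation symmetry. -/
def Jv (z : Fin 4 → ℂ) : Fin 4 → ℂ := ![-z 0, Complex.I * z 1, -(Complex.I * z 2), z 3]

/-- The conjugation symmetry. -/
def Cv (z : Fin 4 → ℂ) : Fin 4 → ℂ := fun i => conj (z i)

lemma herm4_Jv (z v : Fin 4 → ℂ) : herm4 (Jv z) (Jv v) = herm4 z v := by
  simp only [herm4, Jv, Matrix.cons_val, map_neg, map_mul, Complex.conj_I]
  linear_combination (-(z 1 * conj (v 1)) - (z 2 * conj (v 2))) * Complex.I_sq

lemma nvec_succ (θ : ℝ) (k : Fin 4) : nvec θ (k + 1) = Jv (nvec θ k) := by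
  fin_cases k <;> ext i <;> fin_cases i <;> simp [nvec_0, nvec_1, nvec_2, nvec_3, Jv, ← mul_assoc]

lemma Ia_Jv (θ : ℝ) (k : Fin 4) (z : Fin 4 → ℂ) : Ia θ (k + 1) (Jv z) = Jv (Ia θ k z) := by
  rw [Ia_eq, Ia_eq, nvec_succ, herm4_Jv]
  ext i
  fin_cases i <;> simp [Jv] <;> ring

lemma q4_Jv (z : Fin 4 → ℂ) : q4 (Jv z) = q4 z := by rw [q4_eq, q4_eq, herm4_Jv]

lemma DD_Jv (θ : ℝ) (l : List (Fin 4)) (z : Fin 4 → ℂ) :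
    DD θ (l.map (· + 1)) (Jv z) = DD θ l z := by
  induction l generalizing z with
  | nil => simp [DD, Jv]
  | cons a l ih => simp only [List.map_cons, DD, Ia_Jv, ih]

lemma Jv_four (z : Fin 4 → ℂ) : Jv (Jv (Jv (Jv z))) = z := by
  ext i
  fin_cases i <;> simp [Jv, ← mul_assoc]

lemma herm4_Cv (z v : Fin 4 → ℂ) : herm4 (Cv z) (Cv v) = conj (herm4 z v) := by
  simp only [herm4, Cv, map_add, map_sub, map_mul, Complex.conj_conj]

lemma nvec_neg (θ : ℝ) (k : Fin 4) : nvec θ (-k) = Cv (nvec θ k) := by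
  have h1 : (-1 : Fin 4) = 3 := rfl
  have h2 : (-2 : Fin 4) = 2 := rfl
  have h3 : (-3 : Fin 4) = 1 := rfl
  fin_cases k <;> ext i <;> fin_cases i <;> simp [h1, h2, h3, nvec_0, nvec_1, nvec_2, nvec_3, Cv]

lemma Ia_Cv (θ : ℝ) (k : Fin 4) (z : Fin 4 → ℂ) : Ia θ (-k) (Cv z) = Cv (Ia θ k z) := by
  rw [Ia_eq, Ia_eq, nvec_neg, herm4_Cv]
  ext i
  simp only [Cv, Pi.add_apply, Pi.neg_apply, Pi.smul_apply, smul_eq_mul, map_add, map_neg,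
    map_mul, map_ofNat]

lemma q4_Cv (z : Fin 4 → ℂ) : q4 (Cv z) = q4 z := by
  rw [q4_eq, q4_eq, herm4_Cv, Complex.conj_re]

lemma DD_Cv (θ : ℝ) (l : List (Fin 4)) (z : Fin 4 → ℂ) :
    DD θ (l.map (- ·)) (Cv z) = DD θ l z := by
  induction l generalizing z with
  | nil => simp [DD, Cv]
  | cons a l ih => simp only [List.map_cons, DD, Ia_Cv, ih]

lemma Cv_Cv (z : Fin 4 → ℂ) : Cv (Cv z) = z := by
  ext i; simp [Cv]

/-! ### Explicit coordinates -/

lemma xx_0 (θ : ℝ) (z : Fin 4 → ℂ) : xx θ 0 z =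
    2 * tR θ * (naR θ * z 0 + nbR θ * z 1 + ncR θ * z 2 - tR θ * z 3) := by
  simp [xx, herm4, nvec_0, -mul_eq_mul_left_iff]; ring
lemma xx_1 (θ : ℝ) (z : Fin 4 → ℂ) : xx θ 1 z =
    2 * tR θ * (-naR θ * z 0 - Complex.I * nbR θ * z 1 + Complex.I * ncR θ * z 2
      - tR θ * z 3) := by
  simp [xx, herm4, nvec_1, -mul_eq_mul_left_iff]; ring
lemma xx_2 (θ : ℝ) (z : Fin 4 → ℂ) : xx θ 2 z =
    2 * tR θ * (naR θ * z 0 - nbR θ * z 1 - ncR θ * z 2 - tR θ * z 3) := by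
  simp [xx, herm4, nvec_2, -mul_eq_mul_left_iff]; ring
lemma xx_3 (θ : ℝ) (z : Fin 4 → ℂ) : xx θ 3 z =
    2 * tR θ * (-naR θ * z 0 + Complex.I * nbR θ * z 1 - Complex.I * ncR θ * z 2
      - tR θ * z 3) := by
  simp [xx, herm4, nvec_3, -mul_eq_mul_left_iff]; ring

lemma t_sqC {θ : ℝ} (h : Adm θ) : (tR θ : ℂ) ^ 2 = (-1 - 2 * (Real.cos θ : ℂ)) / 4 := by
  rw [← Complex.ofReal_pow, h.t_sq]; push_cast; ring

lemma DD_nil (θ : ℝ) (z : Fin 4 → ℂ) : DD θ [] z = ‖z 3‖ := rfl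

lemma DD_one (θ : ℝ) (k : Fin 4) (z : Fin 4 → ℂ) : DD θ [k] z = ‖z 3 - xx θ k z‖ := by
  rw [DD, DD, Ia_last, ← norm_neg]; congr 1; ring

lemma DD_pair {θ : ℝ} (h : Adm θ) (k j : Fin 4) (z : Fin 4 → ℂ) :
    DD θ [k, j] z = ‖z 3 - (1 - 2 * gramK θ k j) * xx θ k z - xx θ j z‖ := by
  rw [DD, DD_one, Ia_last, xx_Ia h, ← norm_neg]; congr 1; ring

lemma DD_two_comm {θ : ℝ} (h : Adm θ) (k : Fin 4) (l : List (Fin 4)) (z : Fin 4 → ℂ) :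
    DD θ ((k + 2) :: k :: l) z = DD θ (k :: (k + 2) :: l) z := by
  simp only [DD, Ia_comm h]


/-! ### The generic estimate -/

lemma cs3 (a1 a2 a3 b1 b2 b3 : ℝ) :
    (a1 * b1 + a2 * b2 + a3 * b3) ^ 2 ≤
      (a1 ^ 2 + a2 ^ 2 + a3 ^ 2) * (b1 ^ 2 + b2 ^ 2 + b3 ^ 2) := by
  nlinarith [sq_nonneg (a1 * b2 - a2 * b1), sq_nonneg (a1 * b3 - a3 * b1),
    sq_nonneg (a2 * b3 - a3 * b2)]

lemma neg_norm {z : Fin 4 → ℂ} (hz : q4 z < 0) :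
    ‖z 0‖ ^ 2 + ‖z 1‖ ^ 2 + ‖z 2‖ ^ 2 < ‖z 3‖ ^ 2 := by
  simp only [q4, Complex.normSq_eq_norm_sq] at hz; linarith

lemma generic {θ : ℝ} (h : Adm θ) {z : Fin 4 → ℂ} (hz : q4 z < 0) (c0 c1 c2 c3 : ℂ)
    (hn : ‖2 * z 3 - (c0 * xx θ 0 z + c1 * xx θ 1 z + c2 * xx θ 2 z + c3 * xx θ 3 z)‖
      ≤ 2 * ‖z 3‖)
    (hS : 0 < (c0 + c1 + c2 + c3).re)
    (hQ : (1 - 2 * Real.cos θ) * Complex.normSq (c0 - c1 + c2 - c3)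
      + (1 - 2 * Real.sin θ) * Complex.normSq (c0 - Complex.I * c1 - c2 + Complex.I * c3)
      + (1 + 2 * Real.sin θ) * Complex.normSq (c0 + Complex.I * c1 - c2 - Complex.I * c3)
      ≤ (-1 - 2 * Real.cos θ) * (c0 + c1 + c2 + c3).re ^ 2) : False := by
  have hz' := neg_norm hz
  set A := c0 - c1 + c2 - c3 with hA
  set B := c0 - Complex.I * c1 - c2 + Complex.I * c3 with hB
  set G := c0 + Complex.I * c1 - c2 - Complex.I * c3 with hG
  set S := c0 + c1 + c2 + c3 with hSd
  set L := naR θ * A * z 0 + nbR θ * B * z 1 + ncR θ * G * z 2 with hL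
  have ht := h.t_pos
  have hid : (2 + 2 * (tR θ : ℂ) ^ 2 * S) * z 3 =
      (2 * z 3 - (c0 * xx θ 0 z + c1 * xx θ 1 z + c2 * xx θ 2 z + c3 * xx θ 3 z))
        + 2 * (tR θ : ℂ) * L := by
    rw [xx_0, xx_1, xx_2, xx_3, hL, hA, hB, hG, hSd]; ring
  have h1 : ‖(2 + 2 * (tR θ : ℂ) ^ 2 * S) * z 3‖ ≤ 2 * ‖z 3‖ + 2 * tR θ * ‖L‖ := by
    rw [hid]
    refine (norm_add_le _ _).trans (add_le_add hn ?_)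
    rw [norm_mul, norm_mul, Complex.norm_real, Real.norm_of_nonneg ht.le]; simp
  have h2 : 2 + 2 * tR θ ^ 2 * S.re ≤ ‖2 + 2 * (tR θ : ℂ) ^ 2 * S‖ := by
    refine le_trans (le_of_eq ?_) (Complex.re_le_norm _)
    rw [← Complex.ofReal_pow]
    simp [mul_assoc, -Complex.ofReal_pow]
  rw [norm_mul] at h1
  have hw : 0 ≤ ‖z 3‖ := norm_nonneg _
  have h3 : tR θ * S.re * ‖z 3‖ ≤ ‖L‖ := by
    have h4 := mul_le_mul_of_nonneg_right h2 hw
    have h5 : 2 * tR θ * (tR θ * S.re * ‖z 3‖) ≤ 2 * tR θ * ‖L‖ := by nlinarith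
    exact le_of_mul_le_mul_left h5 (by positivity)
  have hnn : ∀ x : ℝ, ‖(x : ℂ)‖ = |x| := fun x => Complex.norm_real x
  have h6 : ‖L‖ ≤ (|naR θ| * ‖A‖) * ‖z 0‖ + (|nbR θ| * ‖B‖) * ‖z 1‖ + (|ncR θ| * ‖G‖) * ‖z 2‖ := by
    rw [hL]
    refine (norm_add₃_le).trans (le_of_eq ?_)
    simp only [norm_mul, hnn]
  have h7 := cs3 (|naR θ| * ‖A‖) (|nbR θ| * ‖B‖) (|ncR θ| * ‖G‖) ‖z 0‖ ‖z 1‖ ‖z 2‖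
  simp only [Complex.normSq_eq_norm_sq] at hQ
  have h8 : (|naR θ| * ‖A‖) ^ 2 + (|nbR θ| * ‖B‖) ^ 2 + (|ncR θ| * ‖G‖) ^ 2
      ≤ tR θ ^ 2 * S.re ^ 2 := by
    simp only [mul_pow, sq_abs, h.na_sq, h.nb_sq, h.nc_sq, h.t_sq]; linarith
  have h9 : ‖L‖ ^ 2 ≤ tR θ ^ 2 * S.re ^ 2 * (‖z 0‖ ^ 2 + ‖z 1‖ ^ 2 + ‖z 2‖ ^ 2) :=
    (pow_le_pow_left₀ (norm_nonneg _) h6 2).trans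
      (h7.trans (mul_le_mul_of_nonneg_right h8 (by positivity)))
  have h10 : (tR θ * S.re * ‖z 3‖) ^ 2 ≤ ‖L‖ ^ 2 :=
    pow_le_pow_left₀ (by positivity) h3 2
  have h11 : tR θ ^ 2 * S.re ^ 2 * (‖z 0‖ ^ 2 + ‖z 1‖ ^ 2 + ‖z 2‖ ^ 2)
      < tR θ ^ 2 * S.re ^ 2 * ‖z 3‖ ^ 2 := mul_lt_mul_of_pos_left hz' (by positivity)
  nlinarith

lemma generic2 {θ : ℝ} (h : Adm θ) {z : Fin 4 → ℂ} (hz : q4 z < 0) (c0 c1 c2 c3 : ℂ)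
    (u v : ℂ) (hu : ‖u‖ ≤ ‖z 3‖) (hv : ‖v‖ ≤ ‖z 3‖)
    (huv : u + v = 2 * z 3 - (c0 * xx θ 0 z + c1 * xx θ 1 z + c2 * xx θ 2 z + c3 * xx θ 3 z))
    (hS : 0 < (c0 + c1 + c2 + c3).re)
    (hQ : (1 - 2 * Real.cos θ) * Complex.normSq (c0 - c1 + c2 - c3)
      + (1 - 2 * Real.sin θ) * Complex.normSq (c0 - Complex.I * c1 - c2 + Complex.I * c3)
      + (1 + 2 * Real.sin θ) * Complex.normSq (c0 + Complex.I * c1 - c2 - Complex.I * c3)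
      ≤ (-1 - 2 * Real.cos θ) * (c0 + c1 + c2 + c3).re ^ 2) : False := by
  refine generic h hz c0 c1 c2 c3 ?_ hS hQ
  rw [← huv]
  linarith [norm_add_le u v]

/-- Two displacement conditions cannot hold simultaneously on the negative cone. -/
def Dis (θ : ℝ) (a b : List (Fin 4)) : Prop :=
  ∀ z, q4 z < 0 → DD θ a z ≤ DD θ [] z → DD θ b z ≤ DD θ [] z → False

lemma Dis.symm {θ : ℝ} {a b : List (Fin 4)} (H : Dis θ a b) : Dis θ b a :=
  fun z hz ha hb => H z hz hb ha

lemma Dis.rot {θ : ℝ} {a b : List (Fin 4)} (H : Dis θ a b) :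
    Dis θ (a.map (· + 1)) (b.map (· + 1)) := by
  intro z hz ha hb
  have hJ : z = Jv (Jv (Jv (Jv z))) := (Jv_four z).symm
  set y := Jv (Jv (Jv z)) with hy
  have hn : DD θ [] z = DD θ [] y := by
    rw [hJ]; exact DD_Jv θ [] y
  refine H y (by rw [hy, q4_Jv, q4_Jv, q4_Jv]; exact hz) ?_ ?_
  · rw [hn, hJ, DD_Jv] at ha; exact ha
  · rw [hn, hJ, DD_Jv] at hb; exact hb

lemma Dis.cj {θ : ℝ} {a b : List (Fin 4)} (H : Dis θ a b) :
    Dis θ (a.map (- ·)) (b.map (- ·)) := by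
  intro z hz ha hb
  have hJ : z = Cv (Cv z) := (Cv_Cv z).symm
  set y := Cv z with hy
  have hn : DD θ [] z = DD θ [] y := by
    rw [hJ]; exact DD_Cv θ [] y
  refine H y (by rw [hy, q4_Cv]; exact hz) ?_ ?_
  · rw [hn, hJ, DD_Cv] at ha; exact ha
  · rw [hn, hJ, DD_Cv] at hb; exact hb

lemma dis_e1 {θ : ℝ} (h : Adm θ) : Dis θ [0, 1] [1, 0] := by
  intro z hz ha hb
  rw [DD_pair h, DD_nil] at ha hb
  have hc := h.c_lt
  have hcs := Real.sin_sq_add_cos_sq θ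
  refine generic2 h hz (2 - 2 * eC θ) (2 - 2 * conj (eC θ)) 0 0 _ _ ha hb ?_ ?_ ?_
  · simp [gramK]; ring
  · simp [eC_re]; linarith
  · simp [Complex.normSq_apply, eC_re, eC_im]
    have hs : Real.sin θ ^ 2 = 1 - Real.cos θ ^ 2 := by linarith
    apply le_of_eq
    ring_nf
    simp only [hs]
    ring



lemma dis_e2 {θ : ℝ} (h : Adm θ) : Dis θ [0, 1] [1, 2] := by
  intro z hz ha hb
  rw [DD_pair h, DD_nil] at ha hb
  have hc := h.c_lt
  have hcs := Real.sin_sq_add_cos_sq θ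
  have hs : Real.sin θ ^ 2 = 1 - Real.cos θ ^ 2 := by linarith
  have hc2 := h.c_sq
  refine generic2 h hz (1 - 2 * eC θ) (2 - 2 * eC θ) 1 0 _ _ ha hb ?_ ?_ ?_
  · simp [gramK]; try ring
  · simp [eC_re]; try linarith
  · simp [Complex.normSq_apply, eC_re, eC_im]
    rw [← sub_nonneg]
    ring_nf
    simp only [hs]
    ring_nf
    nlinarith [mul_nonneg (sub_nonneg.2 hc.le) (sub_nonneg.2 hc2)]

lemma dis_e3 {θ : ℝ} (h : Adm θ) : Dis θ [0, 1] [1, 3] := by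
  intro z hz ha hb
  rw [DD_pair h, DD_nil] at ha hb
  have hc := h.c_lt
  have hcs := Real.sin_sq_add_cos_sq θ
  have hs : Real.sin θ ^ 2 = 1 - Real.cos θ ^ 2 := by linarith
  have hc2 := h.c_sq
  refine generic2 h hz (1 - 2 * eC θ) 2 0 1 _ _ ha hb ?_ ?_ ?_
  · simp [gramK]; try ring
  · simp [eC_re]; try linarith
  · simp [Complex.normSq_apply, eC_re, eC_im]
    rw [← sub_nonneg]
    ring_nf
    simp only [hs]
    ring_nf
    nlinarith [mul_nonneg (sub_nonneg.2 hc.le) (sub_nonneg.2 hc2)]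

lemma dis_e4 {θ : ℝ} (h : Adm θ) : Dis θ [0, 1] [3, 2] := by
  intro z hz ha hb
  rw [DD_pair h, DD_nil] at ha hb
  have hc := h.c_lt
  have hcs := Real.sin_sq_add_cos_sq θ
  have hs : Real.sin θ ^ 2 = 1 - Real.cos θ ^ 2 := by linarith
  have hc2 := h.c_sq
  refine generic2 h hz (1 - 2 * eC θ) 1 1 (1 - 2 * conj (eC θ)) _ _ ha hb ?_ ?_ ?_
  · simp [gramK]; try ring
  · simp [eC_re]; try linarith
  · simp [Complex.normSq_apply, eC_re, eC_im]
    rw [← sub_nonneg]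
    ring_nf
    simp only [hs]
    ring_nf
    nlinarith [mul_nonneg (sub_nonneg.2 hc.le) (sub_nonneg.2 hc2)]

lemma dis_e5 {θ : ℝ} (h : Adm θ) : Dis θ [0, 2] [1, 3] := by
  intro z hz ha hb
  rw [DD_pair h, DD_nil] at ha hb
  have hc := h.c_lt
  have hcs := Real.sin_sq_add_cos_sq θ
  have hc2 := h.c_sq
  refine generic2 h hz 1 1 1 1 _ _ ha hb ?_ ?_ ?_
  · simp [gramK]; try ring
  · simp; norm_num
  · simp [Complex.normSq_apply]
    nlinarith

lemma dis_o1 {θ : ℝ} (h : Adm θ) : Dis θ [1, 0] [3, 0] := by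
  intro z hz ha hb
  rw [DD_pair h, DD_nil] at ha hb
  have hc := h.c_lt
  have hcs := Real.sin_sq_add_cos_sq θ
  have hs : Real.sin θ ^ 2 = 1 - Real.cos θ ^ 2 := by linarith
  have hc2 := h.c_sq
  refine generic2 h hz 2 (1 - 2 * conj (eC θ)) 0 (1 - 2 * eC θ) _ _ ha hb ?_ ?_ ?_
  · simp [gramK]; try ring
  · simp [eC_re]; try linarith
  · simp [Complex.normSq_apply, eC_re, eC_im]
    rw [← sub_nonneg]
    ring_nf
    simp only [hs]
    ring_nf
    nlinarith [mul_nonneg (sub_nonneg.2 hc.le) (sub_nonneg.2 hc2)]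

/-! ### The table of disjoint pairs -/

/-- The five even words attached to the pair `{k, k+2}`. -/
def La (k : Fin 4) : List (List (Fin 4)) :=
  [[k, k + 2], [k, k + 1], [k, k + 3], [k + 2, k + 1], [k + 2, k + 3]]

lemma Dis.comm_left {θ : ℝ} (h : Adm θ) {k : Fin 4} {b : List (Fin 4)}
    (H : Dis θ [k + 2, k] b) : Dis θ [k, k + 2] b := by
  intro z hz ha hb
  exact H z hz (by rwa [DD_two_comm h]) hb

lemma Dis.comm_right {θ : ℝ} (h : Adm θ) {k : Fin 4} {b : List (Fin 4)}
    (H : Dis θ b [k + 2, k]) : Dis θ b [k, k + 2] := (H.symm.comm_left h).symm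

lemma dis_02 {θ : ℝ} (h : Adm θ) : ∀ b ∈ La 1, Dis θ [0, 2] b := by
  have a1 : Dis θ [0, 2] [1, 2] :=
    Dis.comm_left (k := 0) h (dis_e3 h).rot.symm
  have a2 : Dis θ [0, 2] [3, 0] := (dis_e3 h).rot.rot.rot.symm
  have a3 : Dis θ [0, 2] [1, 0] := (dis_e3 h).cj.rot.symm
  have a4 : Dis θ [0, 2] [3, 2] :=
    Dis.comm_left (k := 0) h (dis_e3 h).cj.rot.rot.rot.symm
  intro b hb
  simp only [La, List.mem_cons, List.not_mem_nil, or_false] at hb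
  rcases hb with rfl | rfl | rfl | rfl | rfl
  exacts [dis_e5 h, a1, a3, a4, a2]

lemma dis_01 {θ : ℝ} (h : Adm θ) : ∀ b ∈ La 1, Dis θ [0, 1] b := by
  have a1 : Dis θ [0, 1] [3, 0] := (dis_e2 h).rot.rot.rot.symm
  intro b hb
  simp only [La, List.mem_cons, List.not_mem_nil, or_false] at hb
  rcases hb with rfl | rfl | rfl | rfl | rfl
  exacts [dis_e3 h, dis_e2 h, dis_e1 h, dis_e4 h, a1]

lemma dis_03 {θ : ℝ} (h : Adm θ) : ∀ b ∈ La 1, Dis θ [0, 3] b := by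
  have a1 : Dis θ [0, 3] [1, 3] := Dis.comm_right (k := 1) h (dis_e3 h).cj
  have a2 : Dis θ [0, 3] [3, 2] := (dis_e2 h).cj
  have a3 : Dis θ [0, 3] [1, 0] := (dis_e2 h).cj.rot.symm
  have a4 : Dis θ [0, 3] [1, 2] := (dis_e4 h).cj
  have a5 : Dis θ [0, 3] [3, 0] := (dis_e1 h).rot.rot.rot.symm
  intro b hb
  simp only [La, List.mem_cons, List.not_mem_nil, or_false] at hb
  rcases hb with rfl | rfl | rfl | rfl | rfl
  exacts [a1, a4, a3, a2, a5]

lemma dis_rot2 {θ : ℝ} (h : Adm θ) {a : List (Fin 4)} (H : ∀ b ∈ La 1, Dis θ a b) :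
    ∀ b ∈ La 1, Dis θ ((a.map (· + 1)).map (· + 1)) b := by
  intro b hb
  simp only [La, List.mem_cons, List.not_mem_nil, or_false] at hb
  rcases hb with rfl | rfl | rfl | rfl | rfl
  · exact Dis.comm_right (k := 1) h (H [1, 3] (by decide)).rot.rot
  · exact (H [3, 0] (by decide)).rot.rot
  · exact (H [3, 2] (by decide)).rot.rot
  · exact (H [1, 0] (by decide)).rot.rot
  · exact (H [1, 2] (by decide)).rot.rot

lemma dis_zero {θ : ℝ} (h : Adm θ) : ∀ a ∈ La 0, ∀ b ∈ La 1, Dis θ a b := by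
  intro a ha
  simp only [La, List.mem_cons, List.not_mem_nil, or_false] at ha
  rcases ha with rfl | rfl | rfl | rfl | rfl
  · exact dis_02 h
  · exact dis_01 h
  · exact dis_03 h
  · exact dis_rot2 h (dis_03 h)
  · exact dis_rot2 h (dis_01 h)

lemma La_succ : ∀ k, La (k + 1) = (La k).map (List.map (· + 1)) := by decide

lemma dis_succ {θ : ℝ} {k : Fin 4} (H : ∀ a ∈ La k, ∀ b ∈ La (k + 1), Dis θ a b) :
    ∀ a ∈ La (k + 1), ∀ b ∈ La (k + 1 + 1), Dis θ a b := by
  intro a ha b hb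
  rw [La_succ] at ha hb
  obtain ⟨a', ha', rfl⟩ := List.mem_map.1 ha
  obtain ⟨b', hb', rfl⟩ := List.mem_map.1 hb
  exact (H a' ha' b' hb').rot

lemma dis_all {θ : ℝ} (h : Adm θ) (k : Fin 4) : ∀ a ∈ La k, ∀ b ∈ La (k + 1), Dis θ a b := by
  have h0 := dis_zero h
  have h1 := dis_succ (k := 0) h0
  have h2 := dis_succ (k := 1) h1
  have h3 := dis_succ (k := 2) h2
  fin_cases k
  exacts [h0, h1, h2, h3]


/-! ### The odd estimate -/

lemma DD_130 {θ : ℝ} (h : Adm θ) (z : Fin 4 → ℂ) : DD θ [1, 3, 0] z =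
    ‖z 3 - xx θ 1 z - xx θ 3 z - xx θ 0 z + 2 * conj (eC θ) * xx θ 1 z
      + 2 * eC θ * xx θ 3 z‖ := by
  rw [DD, DD_pair h, Ia_last, xx_Ia h, xx_Ia h, ← norm_neg]
  congr 1
  simp [gramK]
  ring

lemma o2_real1 {C S G D Y : ℝ} (hC : Real.sqrt 3 / 2 ≤ C) (hS0 : 0 ≤ S) (hS : S ≤ 1 / 2)
    (hCS : S ^ 2 + C ^ 2 = 1) (hD : 0 ≤ D) (hG : 0 ≤ G)
    (h1 : Y ^ 2 ≤ G ^ 2 + D ^ 2 / 4) (h2 : 2 * C * G ≤ Y + S * D) :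
    G ≤ Real.sqrt 3 / 2 * D := by
  set r := Real.sqrt 3 / 2 with hr
  have hr2 : r ^ 2 = 3 / 4 := by
    rw [hr, div_pow, Real.sq_sqrt (by norm_num)]; norm_num
  have hr0 : 0 ≤ r := by positivity
  by_contra hlt
  push Not at hlt
  have hC2 : 3 / 4 ≤ C ^ 2 := by nlinarith
  have hpos : 0 ≤ 2 * C * G - S * D := by nlinarith [mul_nonneg hr0 hD]
  have h3 : (2 * C * G - S * D) ^ 2 ≤ G ^ 2 + D ^ 2 / 4 := by
    refine le_trans ?_ h1
    exact pow_le_pow_left₀ hpos (by linarith) 2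
  have hf0 : 0 ≤ 2 * C * (C - 2 * r * S) * D ^ 2 := by
    have : 0 ≤ C - 2 * r * S := by nlinarith
    have : 0 ≤ C := by linarith
    positivity
  have hk : 0 < (4 * C ^ 2 - 1) * (G + r * D) - 4 * C * S * D := by
    have hC1 : C ≤ 1 := by nlinarith
    have hr1 : 4 / 5 ≤ r := by nlinarith
    have e1 : 4 * C * S * D ≤ 2 * D := by
      have : 4 * C * S ≤ 2 := by nlinarith
      exact mul_le_mul_of_nonneg_right this hD
    have e2 : 0 < G := lt_of_le_of_lt (mul_nonneg hr0 hD) hlt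
    have e3 : 2 * (G + r * D) ≤ (4 * C ^ 2 - 1) * (G + r * D) := by
      apply mul_le_mul_of_nonneg_right (by linarith) (by positivity)
    nlinarith
  have hfin := mul_pos (sub_pos.2 hlt) hk
  have hkey : (2 * C * G - S * D) ^ 2 - (G ^ 2 + D ^ 2 / 4) =
      (G - r * D) * ((4 * C ^ 2 - 1) * (G + r * D) - 4 * C * S * D)
        + 2 * C * (C - 2 * r * S) * D ^ 2 := by
    linear_combination D ^ 2 * hCS - (1 - 4 * C ^ 2) * D ^ 2 * hr2
  linarith

lemma o2_real2 {P κ G x Z : ℝ} (hP : 0 < P) (h : G ^ 2 ≤ P * Z) :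
    (G + κ * x) ^ 2 ≤ (P + κ ^ 2) * (Z + x ^ 2) := by
  have h1 : 0 ≤ (P + κ ^ 2) * (P * Z - G ^ 2) + (κ * G - P * x) ^ 2 := by
    have : 0 ≤ P * Z - G ^ 2 := by linarith
    positivity
  refine le_of_mul_le_mul_left (a := P) ?_ hP
  linarith

set_option maxHeartbeats 800000 in
lemma o2_zero {θ : ℝ} (h : Adm θ) {z : Fin 4 → ℂ} (hz : q4 z < 0)
    (h0 : DD θ [1, 3, 0] z ≤ DD θ [2] z) (h1 : DD θ [2] z ≤ DD θ [1] z)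
    (h3 : DD θ [2] z ≤ DD θ [3] z) : False := by
  rw [DD_130 h, DD_one] at h0
  rw [DD_one, DD_one] at h1 h3
  have hz' := neg_norm hz
  have ht := h.t_pos
  have hts := h.t_sq
  have hcl := h.c_lt
  have hcs := Real.sin_sq_add_cos_sq θ
  have hc1 := Real.neg_one_le_cos θ
  set C := -Real.cos θ with hC
  set S := Real.sin θ with hS
  set y := z 3 - xx θ 2 z with hy
  set g := z 3 - (xx θ 1 z + xx θ 3 z) / 2 with hg
  set d := xx θ 1 z - xx θ 3 z with hd
  have hre : (eC θ).re = -C := by rw [eC_re, hC]; ring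
  have hS0 : 0 ≤ S := h.s_nn
  have him : (eC θ).im = S := rfl
  have he : eC θ = -(C : ℂ) + S * Complex.I := by
    apply Complex.ext <;> simp [hre, him]
  have hce : conj (eC θ) = -(C : ℂ) - S * Complex.I := by
    apply Complex.ext <;> simp [hre, him]
  have htC : (tR θ : ℂ) ^ 2 = (2 * (C : ℂ) - 1) / 4 := by
    rw [t_sqC h, hC]; push_cast; ring
  have hsum : xx θ 0 z + xx θ 1 z + xx θ 2 z + xx θ 3 z = -2 * (2 * C - 1) * z 3 := by
    rw [xx_0, xx_1, xx_2, xx_3]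
    linear_combination -8 * z 3 * htC
  -- the first inequality
  have k1 : 2 * C * ‖g‖ ≤ ‖y‖ + S * ‖d‖ := by
    have id1 : 4 * (C : ℂ) * g = (z 3 - xx θ 1 z - xx θ 3 z - xx θ 0 z
        + 2 * conj (eC θ) * xx θ 1 z + 2 * eC θ * xx θ 3 z) + y + 2 * S * Complex.I * d := by
      rw [hce, he, hg, hy, hd]
      linear_combination hsum
    have n1 : ‖4 * (C : ℂ) * g‖ = 4 * C * ‖g‖ := by
      rw [norm_mul, norm_mul, Complex.norm_real, Real.norm_of_nonneg (by linarith)]; simp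
    have n2 : ‖2 * (S : ℂ) * Complex.I * d‖ = 2 * S * ‖d‖ := by
      rw [norm_mul, norm_mul, norm_mul, Complex.norm_real, Real.norm_of_nonneg hS0]; simp
    have n3 := norm_add₃_le (a := z 3 - xx θ 1 z - xx θ 3 z - xx θ 0 z
        + 2 * conj (eC θ) * xx θ 1 z + 2 * eC θ * xx θ 3 z) (b := y) (c := 2 * S * Complex.I * d)
    rw [← id1, n1, n2] at n3
    linarith
  -- the parallelogram law
  have k2 : ‖y‖ ^ 2 ≤ ‖g‖ ^ 2 + ‖d‖ ^ 2 / 4 := by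
    have e1 := pow_le_pow_left₀ (norm_nonneg _) h1 2
    have e2 := pow_le_pow_left₀ (norm_nonneg _) h3 2
    have e3 : ‖z 3 - xx θ 1 z‖ ^ 2 + ‖z 3 - xx θ 3 z‖ ^ 2 = 2 * ‖g‖ ^ 2 + ‖d‖ ^ 2 / 2 := by
      simp only [← Complex.normSq_eq_norm_sq, Complex.normSq_apply, hg, hd]
      simp
      ring
    linarith
  have k3 : ‖g‖ ≤ Real.sqrt 3 / 2 * ‖d‖ :=
    o2_real1 (by linarith [h.c_le]) h.s_nn h.s_le (by rw [hC, neg_sq]; exact hcs)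
      (norm_nonneg _) (norm_nonneg _) k2 k1
  have k4 : ‖d‖ ^ 2 ≤ 2 * (2 * C - 1) * (‖z 1‖ ^ 2 + ‖z 2‖ ^ 2) := by
    have hd' : d = 4 * tR θ * Complex.I * (ncR θ * z 2 - nbR θ * z 1) := by
      rw [hd, xx_1, xx_3]; ring
    have e1 : ‖d‖ = 4 * tR θ * ‖ncR θ * z 2 - nbR θ * z 1‖ := by
      rw [hd', norm_mul, norm_mul, norm_mul, Complex.norm_real, Real.norm_of_nonneg ht.le]; simp
    have e2 : ‖ncR θ * z 2 - nbR θ * z 1‖ ≤ |ncR θ| * ‖z 2‖ + |nbR θ| * ‖z 1‖ := by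
      refine (norm_sub_le _ _).trans (le_of_eq ?_)
      rw [norm_mul, norm_mul, Complex.norm_real, Complex.norm_real]; rfl
    have e3 := pow_le_pow_left₀ (norm_nonneg _) e2 2
    have e4 := cs3 |ncR θ| |nbR θ| 0 ‖z 2‖ ‖z 1‖ 0
    simp only [sq_abs, h.nb_sq, h.nc_sq] at e4
    have e5 : ‖ncR θ * z 2 - nbR θ * z 1‖ ^ 2 ≤ (‖z 1‖ ^ 2 + ‖z 2‖ ^ 2) / 2 := by
      nlinarith
    rw [e1, mul_pow, mul_pow, hts]
    have : 0 ≤ 2 * C - 1 := by linarith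
    nlinarith [mul_le_mul_of_nonneg_left e5 this]
  set κ := 2 * tR θ * naR θ with hκ
  have hκ2 : κ ^ 2 = (4 * C ^ 2 - 1) / 4 := by
    rw [hκ, mul_pow, mul_pow, hts, h.na_sq]; ring
  have hκ0 : 0 ≤ κ := by
    have : 0 ≤ naR θ := by rw [naR]; positivity
    positivity
  have k5 : (C + 1 / 2) * ‖z 3‖ ≤ ‖g‖ + κ * ‖z 0‖ := by
    have id2 : ((C + 1 / 2 : ℝ) : ℂ) * z 3 = g - (κ : ℂ) * z 0 := by
      rw [hg, xx_1, xx_3, hκ]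
      push_cast
      linear_combination -2 * z 3 * htC
    have n1 : ‖((C + 1 / 2 : ℝ) : ℂ) * z 3‖ = (C + 1 / 2) * ‖z 3‖ := by
      rw [norm_mul, Complex.norm_real, Real.norm_of_nonneg (by linarith)]
    rw [← n1, id2]
    refine (norm_sub_le _ _).trans (le_of_eq ?_)
    rw [norm_mul, Complex.norm_real, Real.norm_of_nonneg hκ0]
  have k6 : ‖g‖ ^ 2 ≤ 3 / 2 * (2 * C - 1) * (‖z 1‖ ^ 2 + ‖z 2‖ ^ 2) := by
    have e1 := pow_le_pow_left₀ (norm_nonneg _) k3 2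
    rw [mul_pow, div_pow, Real.sq_sqrt (by norm_num)] at e1
    linarith
  have k7 := pow_le_pow_left₀ (mul_nonneg (by linarith) (norm_nonneg _)) k5 2
  set P := 3 / 2 * (2 * C - 1) with hP
  have hP0 : 0 < P := by rw [hP]; linarith
  have k8 : (‖g‖ + κ * ‖z 0‖) ^ 2 ≤
      (P + κ ^ 2) * (‖z 1‖ ^ 2 + ‖z 2‖ ^ 2 + ‖z 0‖ ^ 2) := by
    exact o2_real2 hP0 k6
  have k9 : P + κ ^ 2 ≤ (C + 1 / 2) ^ 2 := by 
    have hC1 : C ≤ 1 := by linarith only [hc1, hC]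
    rw [hκ2, hP]; linarith only [hC1]
  have k10 : (P + κ ^ 2) * (‖z 1‖ ^ 2 + ‖z 2‖ ^ 2 + ‖z 0‖ ^ 2) <
      (C + 1 / 2) ^ 2 * ‖z 3‖ ^ 2 := by
    refine lt_of_le_of_lt (mul_le_mul_of_nonneg_right k9 (by positivity)) ?_
    have hC0 : 0 < C + 1 / 2 := by linarith
    exact mul_lt_mul_of_pos_left (by linarith) (by positivity)
  rw [mul_pow] at k7
  linarith


/-! ### Ping-pong sets -/

lemma f12 : ∀ k : Fin 4, k + 1 + 2 = k + 3 := by decide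
lemma f13 : ∀ k : Fin 4, k + 1 + 3 = k := by decide
lemma f11 : ∀ k : Fin 4, k + 1 + 1 = k + 2 := by decide
lemma f21 : ∀ k : Fin 4, k + 2 + 1 = k + 3 := by decide
lemma f22 : ∀ k : Fin 4, k + 2 + 2 = k := by decide
lemma f23 : ∀ k : Fin 4, k + 2 + 3 = k + 1 := by decide
lemma f31 : ∀ k : Fin 4, k + 3 + 1 = k := by decide
lemma f32 : ∀ k : Fin 4, k + 3 + 2 = k + 1 := by decide
lemma f33 : ∀ k : Fin 4, k + 3 + 3 = k + 2 := by decide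

lemma dis_o1_all {θ : ℝ} (h : Adm θ) (k : Fin 4) : Dis θ [k + 1, k] [k + 3, k] := by
  have h0 := dis_o1 h
  fin_cases k
  exacts [h0, h0.rot, h0.rot.rot, h0.rot.rot.rot]

/-- The statement of the odd estimate at index `k`. -/
def O2 (θ : ℝ) (k : Fin 4) : Prop :=
  ∀ z, q4 z < 0 → DD θ [k + 1, k + 3, k] z ≤ DD θ [k + 2] z → DD θ [k + 2] z ≤ DD θ [k + 1] z →
    DD θ [k + 2] z ≤ DD θ [k + 3] z → False

lemma O2_succ {θ : ℝ} {k : Fin 4} (H : O2 θ k) : O2 θ (k + 1) := by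
  intro z hz h0 h1 h3
  have hJ : z = Jv (Jv (Jv (Jv z))) := (Jv_four z).symm
  set y := Jv (Jv (Jv z)) with hy
  have hq : q4 y < 0 := by rw [hy, q4_Jv, q4_Jv, q4_Jv]; exact hz
  have e0 := DD_Jv θ [k + 1, k + 3, k] y
  have e1 := DD_Jv θ [k + 1] y
  have e2 := DD_Jv θ [k + 2] y
  have e3 := DD_Jv θ [k + 3] y
  simp only [List.map_cons, List.map_nil, ← hJ, f11, f21, f31] at e0 e1 e2 e3
  simp only [f11, f12, f13] at h0 h1 h3
  rw [e0, e2] at h0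
  rw [e1, e2] at h1
  rw [e2, e3] at h3
  exact H y hq h0 h1 h3

lemma O2_all {θ : ℝ} (h : Adm θ) (k : Fin 4) : O2 θ k := by
  have h0 : O2 θ 0 := fun z hz a b c => o2_zero h hz a b c
  have h1 : O2 θ 1 := by
    have := O2_succ h0
    rwa [show (0 : Fin 4) + 1 = 1 by decide] at this
  have h2 : O2 θ 2 := by
    have := O2_succ h1
    rwa [show (1 : Fin 4) + 1 = 2 by decide] at this
  have h3 : O2 θ 3 := by
    have := O2_succ h2
    rwa [show (2 : Fin 4) + 1 = 3 by decide] at this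
  obtain rfl | rfl | rfl | rfl : k = 0 ∨ k = 1 ∨ k = 2 ∨ k = 3 := by revert k; decide
  exacts [h0, h1, h2, h3]

lemma O3 {θ : ℝ} (h : Adm θ) (k : Fin 4) {z : Fin 4 → ℂ} (hz : q4 z < 0)
    (h0 : DD θ [k + 1, k + 3, k] z ≤ DD θ [k] z) (h2 : DD θ [k + 1, k + 3, k] z ≤ DD θ [k + 2] z) :
    min (DD θ [k + 1] z) (DD θ [k + 3] z) < min (DD θ [k] z) (DD θ [k + 2] z) := by
  by_contra hcon
  push Not at hcon
  rcases le_total (DD θ [k] z) (DD θ [k + 2] z) with hle | hle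
  · rw [min_eq_left hle, le_min_iff] at hcon
    refine dis_o1_all h k (Ia θ (k + 1) z) (by rwa [q4_Ia h]) ?_ ?_
    · have : DD θ [k + 1, k] (Ia θ (k + 1) z) = DD θ [k] z := by
        simp only [DD, Ia_Ia h]
      rw [this]; exact hcon.1
    · exact h0.trans hcon.1
  · rw [min_eq_right hle, le_min_iff] at hcon
    exact O2_all h k z hz h2 hcon.1 hcon.2

def Xe (θ : ℝ) (k : Fin 4) (z : Fin 4 → ℂ) : Prop := ∃ a ∈ La k, DD θ a z < DD θ [] z
def Ze (θ : ℝ) (k : Fin 4) (z : Fin 4 → ℂ) : Prop := ∀ a ∈ La k, DD θ [] z < DD θ a z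
def Xo (θ : ℝ) (k : Fin 4) (z : Fin 4 → ℂ) : Prop :=
  min (DD θ [k] z) (DD θ [k + 2] z) < min (DD θ [k + 1] z) (DD θ [k + 3] z)

lemma Xe.ze {θ : ℝ} (h : Adm θ) {k : Fin 4} {z : Fin 4 → ℂ} (hz : q4 z < 0)
    (H : Xe θ (k + 1) z) : Ze θ k z := by
  intro a ha
  obtain ⟨b, hb, hlt⟩ := H
  by_contra hcon
  exact dis_all h k a ha b hb z hz (not_lt.1 hcon) hlt.le

lemma Xe.ze' {θ : ℝ} (h : Adm θ) {k : Fin 4} {z : Fin 4 → ℂ} (hz : q4 z < 0)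
    (H : Xe θ k z) : Ze θ (k + 1) z := by
  intro b hb
  obtain ⟨a, ha, hlt⟩ := H
  by_contra hcon
  exact dis_all h k a ha b hb z hz hlt.le (not_lt.1 hcon)

lemma Xo.two {θ : ℝ} {k : Fin 4} {z : Fin 4 → ℂ} (H : Xo θ k z) : Xo θ (k + 2) z := by
  unfold Xo at *
  rw [f22, f21, f23, min_comm, min_comm (DD θ [k + 3] z)]; exact H

lemma Xe_not_Ze {θ : ℝ} {k : Fin 4} {z : Fin 4 → ℂ} (H : Xe θ k z) (H' : Ze θ k z) : False := by
  obtain ⟨a, ha, hlt⟩ := H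
  exact lt_asymm hlt (H' a ha)

/-- Odd syllables from a `Ze` point. -/
lemma S1 {θ : ℝ} (h : Adm θ) {k : Fin 4} {z : Fin 4 → ℂ} (H : Ze θ k z) :
    Xo θ k (Ia θ k z) := by
  have h1 : DD θ [k] (Ia θ k z) = DD θ [] z := by simp only [DD, Ia_Ia h]
  have h2 := H [k, k + 1] (by simp [La])
  have h3 := H [k, k + 3] (by simp [La])
  refine min_lt_of_left_lt ?_
  rw [h1]
  exact lt_min h2 h3

lemma S1' {θ : ℝ} (h : Adm θ) {k : Fin 4} {z : Fin 4 → ℂ} (H : Ze θ k z) :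
    Xo θ k (Ia θ (k + 2) z) := by
  have h1 : DD θ [k + 2] (Ia θ (k + 2) z) = DD θ [] z := by simp only [DD, Ia_Ia h]
  have h2 := H [k + 2, k + 1] (by simp [La])
  have h3 := H [k + 2, k + 3] (by simp [La])
  refine min_lt_of_right_lt ?_
  rw [h1]
  exact lt_min h2 h3

lemma S2 {θ : ℝ} (h : Adm θ) {k : Fin 4} {z : Fin 4 → ℂ} (H : Ze θ k z) :
    Xe θ k (Ia θ k (Ia θ (k + 2) z)) := by
  refine ⟨[k, k + 2], by simp [La], ?_⟩
  have h1 : DD θ [k, k + 2] (Ia θ k (Ia θ (k + 2) z)) = DD θ [] z := by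
    simp only [DD, Ia_Ia h]
  rw [h1]
  have h2 := H [k, k + 2] (by simp [La])
  rw [← DD_two_comm h] at h2
  exact h2

lemma S3 {θ : ℝ} (h : Adm θ) {k : Fin 4} {z : Fin 4 → ℂ} (H : Xo θ (k + 1) z) :
    Xe θ k (Ia θ k z) := by
  have h1 : DD θ [k, k + 1] (Ia θ k z) = DD θ [k + 1] z := by simp only [DD, Ia_Ia h]
  have h3 : DD θ [k, k + 3] (Ia θ k z) = DD θ [k + 3] z := by simp only [DD, Ia_Ia h]
  unfold Xo at H
  rw [f12, f11, f13, lt_min_iff] at H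
  rcases min_lt_iff.1 H.2 with H | H
  · exact ⟨[k, k + 1], by simp [La], by rw [h1]; exact H⟩
  · exact ⟨[k, k + 3], by simp [La], by rw [h3]; exact H⟩

lemma S3' {θ : ℝ} (h : Adm θ) {k : Fin 4} {z : Fin 4 → ℂ} (H : Xo θ (k + 1) z) :
    Xe θ k (Ia θ (k + 2) z) := by
  have h1 : DD θ [k + 2, k + 1] (Ia θ (k + 2) z) = DD θ [k + 1] z := by simp only [DD, Ia_Ia h]
  have h3 : DD θ [k + 2, k + 3] (Ia θ (k + 2) z) = DD θ [k + 3] z := by simp only [DD, Ia_Ia h]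
  unfold Xo at H
  rw [f12, f11, f13, lt_min_iff] at H
  rcases min_lt_iff.1 H.1 with H | H
  · exact ⟨[k + 2, k + 1], by simp [La], by rw [h1]; exact H⟩
  · exact ⟨[k + 2, k + 3], by simp [La], by rw [h3]; exact H⟩

lemma S4 {θ : ℝ} (h : Adm θ) {k : Fin 4} {z : Fin 4 → ℂ} (hz : q4 z < 0) (H : Xo θ (k + 1) z) :
    Xo θ k (Ia θ k (Ia θ (k + 2) z)) := by
  unfold Xo at H
  rw [f12, f11, f13] at H
  set z1 := Ia θ k (Ia θ (k + 2) z) with hz1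
  have hq1 : q4 z1 < 0 := by rw [hz1, q4_Ia h, q4_Ia h]; exact hz
  set m := min (DD θ [k + 1] z) (DD θ [k + 3] z) with hm
  have a1 : m < DD θ [k + 2, k, k + 1] z := by
    by_contra hcon
    have hcon := not_lt.1 hcon
    have := O3 h (k + 1) hz (by rw [f11, f13]; exact hcon.trans (min_le_left _ _))
      (by rw [f11, f12, f13]; exact hcon.trans (min_le_right _ _))
    rw [f11, f12, f13] at this
    exact lt_asymm H this
  have a3 : m < DD θ [k + 2, k, k + 3] z := by
    by_contra hcon
    have hcon := not_lt.1 hcon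
    rw [DD_two_comm h] at hcon
    have := O3 h (k + 3) hz (by rw [f31, f33]; exact hcon.trans (min_le_right _ _))
      (by rw [f31, f32, f33]; exact hcon.trans (min_le_left _ _))
    rw [f31, f32, f33, min_comm, min_comm (DD θ [k + 3] z)] at this
    exact lt_asymm H this
  have b1 : DD θ [k + 1] z1 = DD θ [k + 2, k, k + 1] z := rfl
  have b3 : DD θ [k + 3] z1 = DD θ [k + 2, k, k + 3] z := rfl
  have c1 : DD θ [k, k + 2, k + 1] z1 = DD θ [k + 1] z := by simp only [hz1, DD, Ia_Ia h]
  have c3 : DD θ [k, k + 2, k + 3] z1 = DD θ [k + 3] z := by simp only [hz1, DD, Ia_Ia h]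
  unfold Xo
  rcases le_total (DD θ [k + 1] z) (DD θ [k + 3] z) with hle | hle
  · have hm' : m = DD θ [k + 1] z := min_eq_left hle
    have := O3 h (k + 1) hq1
      (by rw [f11, f13, DD_two_comm h, c1, ← hm', b1]; exact a1.le)
      (by rw [f11, f12, f13, DD_two_comm h, c1, ← hm', b3]; exact a3.le)
    rw [f11, f12, f13, min_comm] at this
    exact this
  · have hm' : m = DD θ [k + 3] z := min_eq_right hle
    have := O3 h (k + 3) hq1
      (by rw [f31, f33, c3, ← hm', b3]; exact a3.le)
      (by rw [f31, f32, f33, c3, ← hm', b1]; exact a1.le)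
    rw [f31, f32, f33, min_comm (DD θ [k + 3] z1)] at this
    exact this

lemma q4_p0 : q4 p0v < 0 := by simp [q4, p0v]

lemma gramK_re_nonpos {θ : ℝ} (h : Adm θ) {k j : Fin 4} (hkj : j ≠ k) : (gramK θ k j).re ≤ 0 := by
  have := h.c_lt
  unfold gramK
  split_ifs
  · contradiction
  · rw [eC_re]; linarith
  · simp
  · rw [Complex.conj_re, eC_re]; linarith

lemma DD_p0 {θ : ℝ} (h : Adm θ) {k j : Fin 4} (hkj : j ≠ k) :
    DD θ [] p0v < DD θ [k, j] p0v := by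
  have hx : ∀ k, xx θ k p0v = ((-(2 * tR θ ^ 2) : ℝ) : ℂ) := by
    intro k
    simp [xx, herm4, p0v, nvec_last]; ring
  rw [DD_pair h, DD_nil, hx, hx]
  have h3 : p0v 3 = 1 := by simp [p0v]
  rw [h3, norm_one]
  refine lt_of_lt_of_le ?_ (Complex.re_le_norm _)
  have hg := gramK_re_nonpos h hkj
  have ht : 0 < tR θ ^ 2 := by have := h.t_pos; positivity
  simp only [Complex.sub_re, Complex.one_re, Complex.ofReal_re, Complex.ofReal_im, mul_zero,
    Complex.mul_re, Complex.re_ofNat, Complex.im_ofNat]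
  nlinarith [mul_nonneg ht.le (neg_nonneg.2 hg)]

lemma Ze_p0 {θ : ℝ} (h : Adm θ) (k : Fin 4) : Ze θ k p0v := by
  intro a ha
  simp only [La, List.mem_cons, List.not_mem_nil, or_false] at ha
  rcases ha with rfl | rfl | rfl | rfl | rfl <;> apply DD_p0 h <;> revert k <;> decide


/-! ### The index-two extension of the presented group and normal forms -/

/-- The presented group. -/
abbrev KK := PresentedGroup relsK

/-- The generators. -/
def aK (i : Fin 4) : KK := PresentedGroup.of i

lemma rel_one {w : FreeGroup (Fin 4)} (hw : w ∈ relsK) : PresentedGroup.mk relsK w = 1 :=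
  PresentedGroup.one_of_mem hw

lemma relK0 : aK 0 * aK 1 * aK 2 * aK 3 = 1 := by
  have := rel_one (w := FreeGroup.of 0 * FreeGroup.of 1 * FreeGroup.of 2 * FreeGroup.of 3)
    (by simp [relsK])
  simpa [aK, PresentedGroup.of] using this
lemma relK1 : (aK 0 * aK 1) ^ 2 = 1 := by
  have := rel_one (w := (FreeGroup.of 0 * FreeGroup.of 1) ^ 2) (by simp [relsK])
  simpa [aK, PresentedGroup.of] using this
lemma relK2 : (aK 1 * aK 2) ^ 2 = 1 := by
  have := rel_one (w := (FreeGroup.of 1 * FreeGroup.of 2) ^ 2) (by simp [relsK])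
  simpa [aK, PresentedGroup.of] using this
lemma relK4 : (aK 3 * aK 0) ^ 2 = 1 := by
  have := rel_one (w := (FreeGroup.of 3 * FreeGroup.of 0) ^ 2) (by simp [relsK])
  simpa [aK, PresentedGroup.of] using this

/-- The elements corresponding to `I₀ I_k`. -/
def bK : Fin 4 → KK := ![1, aK 0, aK 0 * aK 1, aK 0 * aK 1 * aK 2]

/-- Right multiplication by the reflections, on the two cosets (`false` = even). -/
def rK (k : Fin 4) : KK × Bool → KK × Bool
  | (g, false) => (g * (bK k)⁻¹, true)
  | (g, true) => (g * bK k, false)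

lemma rK_rK (k : Fin 4) (x : KK × Bool) : rK k (rK k x) = x := by
  obtain ⟨g, _ | _⟩ := x <;> simp [rK]

lemma rK_snd (k : Fin 4) (x : KK × Bool) : (rK k x).2 = !x.2 := by
  obtain ⟨g, _ | _⟩ := x <;> simp [rK]

lemma b3_inv : (bK 3)⁻¹ = aK 3 := by
  have : bK 3 = aK 0 * aK 1 * aK 2 := rfl
  rw [this]
  exact inv_eq_of_mul_eq_one_right relK0

lemma eq_of_sq {G : Type*} [Group G] {x y : G} (h : (x⁻¹ * y) ^ 2 = 1) : y⁻¹ * x = x⁻¹ * y := by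
  have h2 : (x⁻¹ * y) * (x⁻¹ * y) = 1 := by rw [← pow_two]; exact h
  have := inv_eq_of_mul_eq_one_right h2
  rw [← this]; group

lemma eq_of_sq' {G : Type*} [Group G] {x y : G} (h : (x * y⁻¹) ^ 2 = 1) : y * x⁻¹ = x * y⁻¹ := by
  have h2 : (x * y⁻¹) * (x * y⁻¹) = 1 := by rw [← pow_two]; exact h
  have := inv_eq_of_mul_eq_one_right h2
  rw [← this]; group

lemma b02 : ((bK 0)⁻¹ * bK 2) ^ 2 = 1 := by
  have h0 : bK 0 = 1 := rfl
  have h2 : bK 2 = aK 0 * aK 1 := rfl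
  rw [h0, h2, inv_one, one_mul, relK1]
lemma b02' : (bK 0 * (bK 2)⁻¹) ^ 2 = 1 := by
  have h0 : bK 0 = 1 := rfl
  have h2 : bK 2 = aK 0 * aK 1 := rfl
  rw [h0, h2, one_mul, inv_pow, relK1, inv_one]
lemma b13 : ((bK 1)⁻¹ * bK 3) ^ 2 = 1 := by
  have h1 : bK 1 = aK 0 := rfl
  have h3 : bK 3 = aK 0 * aK 1 * aK 2 := rfl
  have : (bK 1)⁻¹ * bK 3 = aK 1 * aK 2 := by rw [h1, h3]; group
  rw [this, relK2]
lemma b13' : (bK 1 * (bK 3)⁻¹) ^ 2 = 1 := by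
  have h1 : bK 1 = aK 0 := rfl
  rw [b3_inv, h1]
  have : (aK 0 * aK 3) ^ 2 = aK 0 * (aK 3 * aK 0) ^ 2 * (aK 0)⁻¹ := by
    simp only [pow_two]; group
  rw [this, relK4]; group

lemma rK_comm_aux {k j : Fin 4} (h1 : ((bK k)⁻¹ * bK j) ^ 2 = 1) (h2 : (bK k * (bK j)⁻¹) ^ 2 = 1)
    (x : KK × Bool) : rK k (rK j x) = rK j (rK k x) := by
  obtain ⟨g, _ | _⟩ := x
  · simp only [rK, mul_assoc, eq_of_sq h1]
  · simp only [rK, mul_assoc, eq_of_sq' h2]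

lemma rK_02 (x : KK × Bool) : rK 0 (rK 2 x) = rK 2 (rK 0 x) := rK_comm_aux b02 b02' x
lemma rK_13 (x : KK × Bool) : rK 1 (rK 3 x) = rK 3 (rK 1 x) := rK_comm_aux b13 b13' x

lemma b_step (k : Fin 4) : (bK k)⁻¹ * bK (k + 1) = aK k := by
  obtain rfl | rfl | rfl | rfl : k = 0 ∨ k = 1 ∨ k = 2 ∨ k = 3 := by revert k; decide
  · change (1 : KK)⁻¹ * aK 0 = aK 0; group
  · change (aK 0)⁻¹ * (aK 0 * aK 1) = aK 1; group
  · change (aK 0 * aK 1)⁻¹ * (aK 0 * aK 1 * aK 2) = aK 2; group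
  · rw [b3_inv]; change aK 3 * 1 = aK 3; group

lemma rK_step (k : Fin 4) (g : KK) : rK (k + 1) (rK k (g, false)) = (g * aK k, false) := by
  simp only [rK, mul_assoc, b_step]

/-- The base index of a syllable type. -/
def kb : Bool → Fin 4
  | false => 0
  | true => 1

lemma rK_kb (s : Bool) (x : KK × Bool) :
    rK (kb s) (rK (kb s + 2) x) = rK (kb s + 2) (rK (kb s) x) := by
  cases s
  · exact rK_02 x
  · exact rK_13 x

/-- Normal forms: alternating products of syllables of the two types. -/
inductive NF : Option Bool → KK × Bool → Prop
  | nil : NF none (1, false)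
  | lo (o : Option Bool) (s : Bool) (x : KK × Bool) (ho : o ≠ some s) (hx : NF o x) :
      NF (some s) (rK (kb s) x)
  | hi (o : Option Bool) (s : Bool) (x : KK × Bool) (ho : o ≠ some s) (hx : NF o x) :
      NF (some s) (rK (kb s + 2) x)
  | both (o : Option Bool) (s : Bool) (x : KK × Bool) (ho : o ≠ some s) (hx : NF o x) :
      NF (some s) (rK (kb s) (rK (kb s + 2) x))

lemma NF.lo_closed {o : Option Bool} {x : KK × Bool} (H : NF o x) (s : Bool) :
    ∃ o', NF o' (rK (kb s) x) := by
  by_cases ho : o = some s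
  · cases H with
    | nil => cases ho
    | lo o s' x ho' hx =>
      obtain rfl : s' = s := by simpa using ho
      rw [rK_rK]; exact ⟨_, hx⟩
    | hi o s' x ho' hx =>
      obtain rfl : s' = s := by simpa using ho
      exact ⟨_, NF.both o s' x ho' hx⟩
    | both o s' x ho' hx =>
      obtain rfl : s' = s := by simpa using ho
      rw [rK_rK]; exact ⟨_, NF.hi o s' x ho' hx⟩
  · exact ⟨_, NF.lo o s x ho H⟩

lemma NF.hi_closed {o : Option Bool} {x : KK × Bool} (H : NF o x) (s : Bool) :
    ∃ o', NF o' (rK (kb s + 2) x) := by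
  by_cases ho : o = some s
  · cases H with
    | nil => cases ho
    | lo o s' x ho' hx =>
      obtain rfl : s' = s := by simpa using ho
      rw [← rK_kb]; exact ⟨_, NF.both o s' x ho' hx⟩
    | hi o s' x ho' hx =>
      obtain rfl : s' = s := by simpa using ho
      rw [rK_rK]; exact ⟨_, hx⟩
    | both o s' x ho' hx =>
      obtain rfl : s' = s := by simpa using ho
      rw [rK_kb, rK_rK]; exact ⟨_, NF.lo o s' x ho' hx⟩
  · exact ⟨_, NF.hi o s x ho H⟩

lemma NF.closed {x : KK × Bool} (H : ∃ o, NF o x) (k : Fin 4) : ∃ o', NF o' (rK k x) := by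
  obtain ⟨o, H⟩ := H
  obtain rfl | rfl | rfl | rfl : k = 0 ∨ k = 1 ∨ k = 2 ∨ k = 3 := by revert k; decide
  exacts [H.lo_closed false, H.lo_closed true, H.hi_closed false, H.hi_closed true]

lemma NF.all (g : KK) : ∃ o, NF o (g, false) := by
  have key : ∀ g : KK, ∀ h : KK, (∃ o, NF o (h, false)) ↔ ∃ o, NF o (h * g, false) := by
    intro g
    have hg : g ∈ Subgroup.closure (Set.range (PresentedGroup.of : Fin 4 → KK)) := by
      rw [PresentedGroup.closure_range_of]; trivial
    induction hg using Subgroup.closure_induction with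
    | mem x hx =>
      obtain ⟨k, rfl⟩ := hx
      intro h
      have hst := rK_step k h
      constructor
      · intro H
        have := NF.closed (NF.closed H k) (k + 1)
        rwa [hst] at this
      · intro H
        have hst' : rK k (rK (k + 1) (h * PresentedGroup.of k, false)) = (h, false) := by
          change rK k (rK (k + 1) (h * aK k, false)) = (h, false)
          rw [← hst, rK_rK, rK_rK]
        have := NF.closed (NF.closed H (k + 1)) k
        rwa [hst'] at this
    | one => intro h; rw [mul_one]
    | mul x y _ _ hx hy => intro h; rw [← mul_assoc]; exact (hx h).trans (hy (h * x))
    | inv x _ hx =>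
      intro h
      have := hx (h * x⁻¹)
      rw [inv_mul_cancel_right] at this
      exact this.symm
  have := (key g 1).1 ⟨_, NF.nil⟩
  rwa [one_mul] at this

/-! ### Ping-pong -/

lemma NF.pingpong {θ : ℝ} (h : Adm θ) (Y : KK × Bool → (Fin 4 → ℂ)) (h0 : Y (1, false) = p0v)
    (hY : ∀ k x, Y (rK k x) = Ia θ k (Y x)) {o : Option Bool} {x : KK × Bool} (H : NF o x) :
    q4 (Y x) < 0 ∧ (o = none → x = (1, false)) ∧
      (∀ s, o = some s → (x.2 = false → Xe θ (kb s) (Y x)) ∧ (x.2 = true → Xo θ (kb s) (Y x))) := by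
  have step : ∀ (o : Option Bool) (s : Bool) (x : KK × Bool), o ≠ some s →
      (q4 (Y x) < 0 ∧ (o = none → x = (1, false)) ∧ (∀ s, o = some s →
        (x.2 = false → Xe θ (kb s) (Y x)) ∧ (x.2 = true → Xo θ (kb s) (Y x)))) →
      (x.2 = false → Ze θ (kb s) (Y x)) ∧ (x.2 = true → Xo θ (kb s + 1) (Y x)) := by
    intro o s x ho ⟨hq, hn, hs⟩
    rcases o with _ | s'
    · obtain rfl := hn rfl
      refine ⟨fun _ => by rw [h0]; exact Ze_p0 h _, fun hh => by cases hh⟩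
    · obtain ⟨ha, hb⟩ := hs s' rfl
      cases s <;> cases s'
      · exact absurd rfl ho
      · exact ⟨fun hx => Xe.ze h (k := 0) hq (ha hx), fun hx => hb hx⟩
      · exact ⟨fun hx => Xe.ze' h (k := 0) hq (ha hx), fun hx => (hb hx).two⟩
      · exact absurd rfl ho
  induction H with
  | nil =>
    refine ⟨by rw [h0]; exact q4_p0, fun _ => rfl, fun s hs => by cases hs⟩
  | lo o s x ho hx ih =>
    obtain ⟨hZ, hX⟩ := step o s x ho ih
    refine ⟨by rw [hY, q4_Ia h]; exact ih.1, by simp, ?_⟩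
    intro s' hs'
    obtain rfl : s = s' := by simpa using hs'
    rw [rK_snd, hY]
    exact ⟨fun hh => S3 h (hX (by simpa using hh)), fun hh => S1 h (hZ (by simpa using hh))⟩
  | hi o s x ho hx ih =>
    obtain ⟨hZ, hX⟩ := step o s x ho ih
    refine ⟨by rw [hY, q4_Ia h]; exact ih.1, by simp, ?_⟩
    intro s' hs'
    obtain rfl : s = s' := by simpa using hs'
    rw [rK_snd, hY]
    exact ⟨fun hh => S3' h (hX (by simpa using hh)), fun hh => S1' h (hZ (by simpa using hh))⟩
  | both o s x ho hx ih =>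
    obtain ⟨hZ, hX⟩ := step o s x ho ih
    refine ⟨by rw [hY, hY, q4_Ia h, q4_Ia h]; exact ih.1, by simp, ?_⟩
    intro s' hs'
    obtain rfl : s = s' := by simpa using hs'
    rw [rK_snd, rK_snd, hY, hY]
    exact ⟨fun hh => S2 h (hZ (by simpa using hh)),
      fun hh => S4 h ih.1 (hX (by simpa using hh))⟩

lemma trivial_of_Ze {θ : ℝ} (h : Adm θ) (Y : KK × Bool → (Fin 4 → ℂ)) (h0 : Y (1, false) = p0v)
    (hY : ∀ k x, Y (rK k x) = Ia θ k (Y x)) (g : KK)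
    (hZ0 : Ze θ 0 (Y (g, false))) (hZ1 : Ze θ 1 (Y (g, false))) : g = 1 := by
  obtain ⟨o, ho⟩ := NF.all g
  obtain ⟨_, hn, hs⟩ := NF.pingpong h Y h0 hY ho
  rcases o with _ | s
  · exact congrArg Prod.fst (hn rfl)
  · have hX := (hs s rfl).1 rfl
    cases s
    · exact (Xe_not_Ze hX hZ0).elim
    · exact (Xe_not_Ze hX hZ1).elim


/-! ### Units, the homomorphism, discreteness -/

lemma Iref_mul_self {θ : ℝ} (h : Adm θ) (k : Fin 4) : Iref θ k * Iref θ k = 1 := by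
  apply Matrix.mulVec_injective
  ext1 z
  rw [← Matrix.mulVec_mulVec, Matrix.one_mulVec]
  exact Ia_Ia h k z

lemma Iref_comm {θ : ℝ} (h : Adm θ) (k : Fin 4) :
    Iref θ k * Iref θ (k + 2) = Iref θ (k + 2) * Iref θ k := by
  apply Matrix.mulVec_injective
  ext1 z
  rw [← Matrix.mulVec_mulVec, ← Matrix.mulVec_mulVec]
  exact Ia_comm h k z

/-- The reflections as units. -/
def RU {θ : ℝ} (h : Adm θ) (k : Fin 4) : (Matrix (Fin 4) (Fin 4) ℂ)ˣ :=
  ⟨Iref θ k, Iref θ k, Iref_mul_self h k, Iref_mul_self h k⟩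

lemma RU_mul_self {θ : ℝ} (h : Adm θ) (k : Fin 4) : RU h k * RU h k = 1 :=
  Units.ext (Iref_mul_self h k)

lemma RU_mul_self_assoc {θ : ℝ} (h : Adm θ) (k : Fin 4) (x : (Matrix (Fin 4) (Fin 4) ℂ)ˣ) :
    RU h k * (RU h k * x) = x := by rw [← mul_assoc, RU_mul_self, one_mul]

lemma RU_inv {θ : ℝ} (h : Adm θ) (k : Fin 4) : (RU h k)⁻¹ = RU h k := rfl

lemma RU_comm {θ : ℝ} (h : Adm θ) (k : Fin 4) : RU h k * RU h (k + 2) = RU h (k + 2) * RU h k :=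
  Units.ext (Iref_comm h k)

/-- The matrices `A_i` as units. -/
def AU {θ : ℝ} (h : Adm θ) (k : Fin 4) : (Matrix (Fin 4) (Fin 4) ℂ)ˣ := RU h k * RU h (k + 1)

lemma AU_prod {θ : ℝ} (h : Adm θ) : AU h 0 * AU h 1 * AU h 2 * AU h 3 = 1 := by
  have e1 : AU h 0 = RU h 0 * RU h 1 := rfl
  have e2 : AU h 1 = RU h 1 * RU h 2 := rfl
  have e3 : AU h 2 = RU h 2 * RU h 3 := rfl
  have e4 : AU h 3 = RU h 3 * RU h 0 := rfl
  simp only [e1, e2, e3, e4, mul_assoc, RU_mul_self_assoc, RU_mul_self]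

lemma AU_sq {θ : ℝ} (h : Adm θ) (k : Fin 4) : (AU h k * AU h (k + 1)) ^ 2 = 1 := by
  have e : AU h k * AU h (k + 1) = RU h k * RU h (k + 2) := by
    simp only [AU, f11, mul_assoc, RU_mul_self_assoc]
  rw [e, pow_two]
  nth_rewrite 1 [RU_comm]
  simp only [mul_assoc, RU_mul_self_assoc, RU_mul_self]

lemma AU_rels {θ : ℝ} (h : Adm θ) : ∀ r ∈ relsK, FreeGroup.lift (AU h) r = 1 := by
  intro r hr
  simp only [relsK, Set.mem_insert_iff, Set.mem_singleton_iff] at hr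
  rcases hr with rfl | rfl | rfl | rfl | rfl
  · simpa using AU_prod h
  · simpa using AU_sq h 0
  · simpa using AU_sq h 1
  · simpa using AU_sq h 2
  · simpa using AU_sq h 3

/-- The representation. -/
def phiK {θ : ℝ} (h : Adm θ) : KK →* (Matrix (Fin 4) (Fin 4) ℂ)ˣ :=
  PresentedGroup.toGroup (AU_rels h)

lemma phiK_a {θ : ℝ} (h : Adm θ) (k : Fin 4) : phiK h (aK k) = AU h k :=
  PresentedGroup.toGroup.of (AU_rels h)

lemma phiK_b {θ : ℝ} (h : Adm θ) (k : Fin 4) : phiK h (bK k) = RU h 0 * RU h k := by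
  have e1 : AU h 0 = RU h 0 * RU h 1 := rfl
  have e2 : AU h 1 = RU h 1 * RU h 2 := rfl
  have e3 : AU h 2 = RU h 2 * RU h 3 := rfl
  obtain rfl | rfl | rfl | rfl : k = 0 ∨ k = 1 ∨ k = 2 ∨ k = 3 := by revert k; decide
  · rw [show bK 0 = 1 from rfl, map_one, RU_mul_self]
  · rw [show bK 1 = aK 0 from rfl, phiK_a, e1]
  · rw [show bK 2 = aK 0 * aK 1 from rfl, map_mul, phiK_a, phiK_a, e1, e2]
    simp only [mul_assoc, RU_mul_self_assoc]
  · rw [show bK 3 = aK 0 * aK 1 * aK 2 from rfl, map_mul, map_mul, phiK_a, phiK_a, phiK_a,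
      e1, e2, e3]
    simp only [mul_assoc, RU_mul_self_assoc]

/-- The orbit map on the two cosets, as a unit. -/
def YU {θ : ℝ} (h : Adm θ) : KK × Bool → (Matrix (Fin 4) (Fin 4) ℂ)ˣ
  | (g, false) => (phiK h g)⁻¹
  | (g, true) => RU h 0 * (phiK h g)⁻¹

lemma YU_r {θ : ℝ} (h : Adm θ) (k : Fin 4) (x : KK × Bool) :
    YU h (rK k x) = RU h k * YU h x := by
  obtain ⟨g, _ | _⟩ := x
  · simp only [YU, rK, map_mul, map_inv, phiK_b, _root_.mul_inv_rev, inv_inv, mul_assoc,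
      RU_mul_self_assoc]
  · simp only [YU, rK, map_mul, phiK_b, _root_.mul_inv_rev, RU_inv, mul_assoc]

/-- The orbit map. -/
def YY {θ : ℝ} (h : Adm θ) (x : KK × Bool) : Fin 4 → ℂ :=
  (YU h x : Matrix (Fin 4) (Fin 4) ℂ).mulVec p0v

lemma trivial_of_orbit {θ : ℝ} (h : Adm θ) (g : KK)
    (hZ0 : Ze θ 0 (((phiK h g)⁻¹ : (Matrix (Fin 4) (Fin 4) ℂ)ˣ).val.mulVec p0v))
    (hZ1 : Ze θ 1 (((phiK h g)⁻¹ : (Matrix (Fin 4) (Fin 4) ℂ)ˣ).val.mulVec p0v)) : g = 1 := by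
  refine trivial_of_Ze h (YY h) ?_ ?_ g hZ0 hZ1
  · simp [YY, YU]
  · intro k x
    rw [YY, YU_r, Units.val_mul, ← Matrix.mulVec_mulVec]
    rfl

lemma phiK_injective {θ : ℝ} (h : Adm θ) : Function.Injective (phiK h) := by
  rw [injective_iff_map_eq_one]
  intro g hg
  have e : ((phiK h g)⁻¹ : (Matrix (Fin 4) (Fin 4) ℂ)ˣ).val.mulVec p0v = p0v := by
    rw [hg]; simp
  refine trivial_of_orbit h g ?_ ?_ <;> rw [e] <;> exact Ze_p0 h _

lemma DD_continuous (θ : ℝ) (l : List (Fin 4)) : Continuous (DD θ l) := by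
  induction l with
  | nil => exact (continuous_apply 3).norm
  | cons a l ih =>
    have : DD θ (a :: l) = DD θ l ∘ Ia θ a := rfl
    rw [this]
    exact ih.comp (Continuous.matrix_mulVec continuous_const continuous_id)

lemma Ze_isOpen (θ : ℝ) (k : Fin 4) : IsOpen {z | Ze θ k z} := by
  have : {z | Ze θ k z} = ⋂ a ∈ {a | a ∈ La k}, {z | DD θ [] z < DD θ a z} := by
    ext z; simp [Ze]
  rw [this]
  refine Set.Finite.isOpen_biInter (List.finite_toSet _) fun a _ => ?_
  exact isOpen_lt (DD_continuous θ []) (DD_continuous θ a)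

lemma discrete_closure {θ : ℝ} (h : Adm θ) :
    DiscreteTopology ↥(Subgroup.closure (Set.range (AU h))) := by
  have hle : Subgroup.closure (Set.range (AU h)) ≤ (phiK h).range := by
    rw [Subgroup.closure_le]
    rintro _ ⟨k, rfl⟩
    exact ⟨aK k, phiK_a h k⟩
  have hcont : Continuous (fun M : (Matrix (Fin 4) (Fin 4) ℂ)ˣ =>
      (M⁻¹ : (Matrix (Fin 4) (Fin 4) ℂ)ˣ).val.mulVec p0v) :=
    Continuous.matrix_mulVec (Units.continuous_val.comp continuous_inv) continuous_const
  apply discreteTopology_of_isOpen_singleton_one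
  have hopen := (((Ze_isOpen θ 0).inter (Ze_isOpen θ 1)).preimage hcont).preimage
    (continuous_subtype_val (p := (· ∈ Subgroup.closure (Set.range (AU h)))))
  convert hopen using 1
  ext x
  constructor
  · intro hx
    have hx : x = 1 := hx
    subst hx
    refine ⟨?_, ?_⟩ <;> simpa using Ze_p0 h _
  · rintro ⟨h0, h1⟩
    obtain ⟨g, hg⟩ := hle x.2
    simp only [Set.mem_setOf_eq, ← hg] at h0 h1
    have := trivial_of_orbit h g h0 h1
    rw [this, map_one] at hg
    exact Subtype.ext hg.symm


/-- Main theorem: for every `θ ∈ [5π/6, π]` the matrices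
`A₁,A₂,A₃,A₄` satisfy `A₁A₂A₃A₄ = Id` and `(A_iA_{i+1})² = Id` (indices mod 4);
the induced homomorphism `K → GL(4,ℂ)`, `a_i ↦ A_i`, is injective; and the
subgroup of `GL(4,ℂ)` generated by `A₁,A₂,A₃,A₄` is discrete. -/
theorem main_discrete_faithful (θ : ℝ)
    (hθ : θ ∈ Set.Icc (5 * Real.pi / 6) Real.pi) :
    Amat θ 0 * Amat θ 1 * Amat θ 2 * Amat θ 3 = 1 ∧
    (∀ i : Fin 4, (Amat θ i * Amat θ (i + 1)) ^ 2 = 1) ∧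
    ∃ U : Fin 4 → (Matrix (Fin 4) (Fin 4) ℂ)ˣ,
      (∀ i : Fin 4, (U i : Matrix (Fin 4) (Fin 4) ℂ) = Amat θ i) ∧
      (∃ φ : PresentedGroup relsK →* (Matrix (Fin 4) (Fin 4) ℂ)ˣ,
        (∀ i : Fin 4, φ (PresentedGroup.of i) = U i) ∧ Function.Injective φ) ∧
      DiscreteTopology ↥(Subgroup.closure (Set.range U)) := by
  have h := adm_of_mem hθ
  refine ⟨?_, ?_, AU h, fun i => rfl, ⟨phiK h, fun i => phiK_a h i, phiK_injective h⟩,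
    discrete_closure h⟩
  · exact congrArg Units.val (AU_prod h)
  · intro i
    exact congrArg Units.val (AU_sq h i)
end
end

section
/- (Coplanarity relation among p₀, p₁₂, p₃₄ and p₁₃.) For every θ ∈ [5π/6, π], the linear relation 2·e^{iθ}·p₀ + p₁₂ + p₃₄ + 2·e^{−iθ}·p₁₃ = 0 holds in ℂ⁴. In particular the four vectors p₀, p₁₂, p₃₄, p₁₃ are linearly dependent, i.e. the corresponding four points of complex hyperbolic 3-space lie in a common totally geodesic copy of complex hyperbolic 2-space. -/
open Complex ComplexConjugate Matrix Polynomial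

noncomputable section

/-- The vectors `n_k` in coordinates, in terms of entries `a b c d` of `n₁`. -/
theorem nvec_coord (θ : ℝ) (k : Fin 4) (i : Fin 4) :
    nvec θ k i = (![-1, Complex.I, -Complex.I, 1] : Fin 4 → ℂ) i ^ (k : ℕ) * n1v θ i := by
  unfold nvec J4
  rw [Matrix.diagonal_pow, Matrix.mulVec_diagonal]
  rfl

theorem pv_coord (θ : ℝ) (i j k : Fin 4) :
    pv θ i j k = p0v k + 2 * conj (nvec θ j 3) * nvec θ j k
      + 2 * (-(-1 : ℂ) * conj (nvec θ i 3)
        - 2 * conj (nvec θ j 3) * herm4 (nvec θ j) (nvec θ i)) * nvec θ i k := by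
  have h : ∀ (n z : Fin 4 → ℂ) (l : Fin 4),
      (refl4 n).mulVec z l = - z l + 2 * herm4 z n * n l := by
    intro n z l
    unfold refl4 herm4 eta4
    rw [Matrix.add_mulVec, Matrix.neg_mulVec, Matrix.one_mulVec, Matrix.smul_mulVec]
    simp [Matrix.mulVec, dotProduct, Fin.sum_univ_four, Matrix.vecMulVec_apply]
    ring
  unfold pv Iref
  rw [← Matrix.mulVec_mulVec]
  simp only [h, herm4]
  simp [p0v]
  ring

theorem coplanarity_relation (θ : ℝ)
    (hθ : θ ∈ Set.Icc (5 * Real.pi / 6) Real.pi) :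
    (2 * Complex.exp ((θ : ℂ) * Complex.I)) • p0v + pv θ 0 1 + pv θ 2 3 +
        (2 * Complex.exp (-(θ : ℂ) * Complex.I)) • pv θ 0 2 = 0 ∧
    ¬ LinearIndependent ℂ ![p0v, pv θ 0 1, pv θ 2 3, pv θ 0 2] := by
  have main : (2 * Complex.exp ((θ : ℂ) * Complex.I)) • p0v + pv θ 0 1 + pv θ 2 3 +
        (2 * Complex.exp (-(θ : ℂ) * Complex.I)) • pv θ 0 2 = 0 := by
    have hpi := Real.pi_pos
    obtain ⟨h1, h2⟩ := hθ
    have hs0 : 0 ≤ Real.sin θ := Real.sin_nonneg_of_nonneg_of_le_pi (by linarith) h2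
    have hs1 : Real.sin θ ≤ 1 / 2 := by
      rw [← Real.sin_pi_sub, ← Real.sin_pi_div_six]
      exact Real.sin_le_sin_of_le_of_le_pi_div_two (by linarith) (by linarith) (by linarith)
    have hc : Real.cos θ ≤ -(1 / 2) := by
      have : Real.cos (Real.pi - Real.pi / 3) = -(1/2) := by
        rw [Real.cos_pi_sub, Real.cos_pi_div_three]
      rw [← this]
      exact Real.cos_le_cos_of_nonneg_of_le_pi (by linarith) h2 (by linarith)
    have e1 : Complex.exp ((θ : ℂ) * Complex.I) = (Real.cos θ : ℂ) + (Real.sin θ : ℂ) * Complex.I := by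
      rw [Complex.exp_mul_I]; push_cast; rfl
    have e2 : Complex.exp (-(θ : ℂ) * Complex.I) =
        (Real.cos θ : ℂ) - (Real.sin θ : ℂ) * Complex.I := by
      rw [Complex.exp_mul_I, Complex.cos_neg, Complex.sin_neg]; push_cast; ring
    have hcs : (Real.sin θ : ℂ) ^ 2 + (Real.cos θ : ℂ) ^ 2 = 1 := by
      exact_mod_cast Real.sin_sq_add_cos_sq θ
    have sq : ∀ x : ℝ, 0 ≤ x → ((Real.sqrt x / 2 : ℝ) : ℂ) ^ 2 = (x : ℂ) / 4 := by
      intro x hx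
      rw [← Complex.ofReal_pow, div_pow, Real.sq_sqrt hx]; push_cast; ring
    have ha := sq (1 - 2 * Real.cos θ) (by linarith)
    have hb := sq (1 - 2 * Real.sin θ) (by linarith)
    have hc' := sq (1 + 2 * Real.sin θ) (by linarith)
    have hd := sq (-1 - 2 * Real.cos θ) (by linarith)
    rw [e1, e2]
    have hn : ∀ k i, nvec θ k i = _ := nvec_coord θ
    generalize ea : Real.sqrt (1 - 2 * Real.cos θ) / 2 = a at *
    generalize eb : Real.sqrt (1 - 2 * Real.sin θ) / 2 = b at *
    generalize ec : Real.sqrt (1 + 2 * Real.sin θ) / 2 = c at *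
    generalize ed : Real.sqrt (-1 - 2 * Real.cos θ) / 2 = d at *
    have hn1 : n1v θ = ![(a : ℂ), b, c, d] := by
      simp only [n1v, ea, eb, ec, ed]
    rw [hn1] at hn
    generalize Real.cos θ = C at *
    generalize Real.sin θ = S at *
    push_cast at ha hb hc' hd
    have hI : Complex.I ^ 2 = -1 := Complex.I_sq
    have hI3 : Complex.I ^ 3 = -Complex.I := Complex.I_pow_three
    have hI4 : Complex.I ^ 4 = 1 := Complex.I_pow_four
    funext k
    simp only [Pi.add_apply, Pi.smul_apply, pv_coord, hn, herm4, p0v, smul_eq_mul]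
    fin_cases k <;> simp
    all_goals
      clear ea eb ec ed
      generalize (a : ℂ) = a at *
      generalize (b : ℂ) = b at *
      generalize (c : ℂ) = c at *
      generalize (d : ℂ) = d at *
      generalize (C : ℂ) = C at *
      generalize (S : ℂ) = S at *
      generalize Complex.I = J at *
      clear hn hn1 sq
      grind
  refine ⟨main, fun h => ?_⟩
  have := Fintype.linearIndependent_iff.mp h
    ![2 * Complex.exp ((θ : ℂ) * Complex.I), 1, 1, 2 * Complex.exp (-(θ : ℂ) * Complex.I)]
    (by simpa [Fin.sum_univ_four] using main) 1
  simp at this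
end
end
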